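/- Let g be even, Γ̄ the tropical hyperelliptic curve of genus g, Γ its bounded part, and D* = (g/2)(V_0 + V_0′). The divisor V_1 + V_3 + ⋯ + V_{g−1} + V_1′ + V_3′ + ⋯ + V_{g−1}′ lies in 𝔇̃_g^+(Γ) and is the unique element of 𝔇̃_g^+(Γ) whose image under φ̄ is 0 in J(Γ); hence the g-tuple (V_1, V_3, …, V_{g−1}, V_1′, V_3′, …, V_{g−1}′) is the unit 𝒪 of the group (Γ_g^+, 𝒪). -/

import Mathlib

open scoped BigOperators

namespace TropicalHyperelliptic

/-! ## The tropical hyperelliptic curve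

For a genus `g ≥ 1` and parameters `c₋₁, c₀, …, c_{g+1}` (encoded as a function
`c : ℤ → ℝ`; only the values `c (-1), …, c (g+1)` matter), the tropical
polynomial `F̃(X,Y) = max(2Y, Y + P̃(X), c₋₁)` with
`P̃(X) = max_{0 ≤ i ≤ g+1} (c_i + iX)` defines the tropical hyperelliptic curve
`Γ̄` as the locus of points of `ℝ²` where `F̃` fails to be differentiable. -/

/-- The tropical polynomial `P̃(X) = max_{0 ≤ i ≤ g+1} (c_i + i X)`. -/
noncomputable def Ptilde (g : ℕ) (c : ℤ → ℝ) (X : ℝ) : ℝ :=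
  (Finset.range (g + 2)).sup' (Finset.nonempty_range_iff.mpr (by omega))
    fun i => c (i : ℤ) + (i : ℝ) * X

/-- The tropical polynomial `F̃(X,Y) = max(2Y, Y + P̃(X), c₋₁)`. -/
noncomputable def Ftilde (g : ℕ) (c : ℤ → ℝ) (P : ℝ × ℝ) : ℝ :=
  max (2 * P.2) (max (P.2 + Ptilde g c P.1) (c (-1)))

/-- The tropical hyperelliptic curve `Γ̄` of genus `g`: the set of points of
`ℝ²` at which `F̃` is not differentiable. -/
def curveBar (g : ℕ) (c : ℤ → ℝ) : Set (ℝ × ℝ) :=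
  {P | ¬ DifferentiableAt ℝ (Ftilde g c) P}

/-- The hypotheses on the parameters: `c_{g+1} = c_g = 0`, `c₋₁ < 2c₀`,
`cᵢ + c_{i+2} < 2c_{i+1}` for `0 ≤ i ≤ g − 2`, and `c_{g−1} < 2c_g = 0`.
Under these assumptions `Γ̄` is a smooth tropical curve of genus `g`. -/
def Hyp (g : ℕ) (c : ℤ → ℝ) : Prop :=
  c ((g : ℤ) + 1) = 0 ∧ c (g : ℤ) = 0 ∧ c (-1) < 2 * c 0 ∧
  (∀ i : ℕ, (i : ℤ) ≤ (g : ℤ) - 2 → c i + c ((i : ℤ) + 2) < 2 * c ((i : ℤ) + 1)) ∧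
  c ((g : ℤ) - 1) < 0

/-- The vertices `V_i` (`0 ≤ i ≤ g`) of `Γ̄` lying above the line
`Y = c₋₁/2`:  `V_0 = (0,0)` and
`V_i = (c_{g−i} − c_{g−i+1}, (g−i+1)c_{g−i} − (g−i)c_{g−i+1})`.
(The formula below also gives `V_0 = (0,0)` for `i = 0`, since
`c_g = c_{g+1} = 0`.) -/
noncomputable def V (g : ℕ) (c : ℤ → ℝ) (i : ℕ) : ℝ × ℝ :=
  (c ((g : ℤ) - i) - c ((g : ℤ) - i + 1),
   (((g : ℤ) - i + 1 : ℤ) : ℝ) * c ((g : ℤ) - i)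
     - (((g : ℤ) - i : ℤ) : ℝ) * c ((g : ℤ) - i + 1))

/-- The conjugate `P′` of a point `P`: the reflection with respect to the line
`Y = c₋₁/2`. -/
def conj (c : ℤ → ℝ) (P : ℝ × ℝ) : ℝ × ℝ := (P.1, c (-1) - P.2)

/-- The metric graph `Γ` obtained from `Γ̄` by removing all unbounded edges:
the part of `Γ̄` lying in the vertical strip `x(V_g) ≤ X ≤ x(V_0) = 0`,
where `x(V_g) = c_0 − c_1`. -/
def Gam (g : ℕ) (c : ℤ → ℝ) : Set (ℝ × ℝ) :=
  {P ∈ curveBar g c | c 0 - c 1 ≤ P.1 ∧ P.1 ≤ 0}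

/-! ## Rational functions, orders, and divisors -/

/-- The image in `ℝ²` of an integer vector. -/
def vr (v : ℤ × ℤ) : ℝ × ℝ := ((v.1 : ℝ), (v.2 : ℝ))

/-- The primitive integer directions along which one can leave the point `P`
inside the set `S` (the outgoing directions of the segments of `S` emanating
from `P`). -/
def localDirs (S : Set (ℝ × ℝ)) (P : ℝ × ℝ) : Set (ℤ × ℤ) :=
  {v | IsCoprime v.1 v.2 ∧ ∃ ε > (0 : ℝ), ∀ t : ℝ, 0 < t → t < ε → P + t • vr v ∈ S}

/-- `f` has (integer) outgoing slope `s` at `P` in the direction `v` (slopes are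
measured with respect to the lattice length). -/
def HasSlope (S : Set (ℝ × ℝ)) (f : ℝ × ℝ → ℝ) (P : ℝ × ℝ) (v : ℤ × ℤ) (s : ℤ) : Prop :=
  ∃ ε > (0 : ℝ), ∀ t : ℝ, 0 ≤ t → t < ε → P + t • vr v ∈ S →
    f (P + t • vr v) = f P + (s : ℝ) * t

/-- A rational function on (the tropical curve) `S ⊆ ℝ²`: a continuous function
whose restriction to every edge is piecewise linear with integer slopes,
i.e. which has an integer outgoing slope at every point of `S` in every
outgoing direction. -/
structure IsRationalFn (S : Set (ℝ × ℝ)) (f : ℝ × ℝ → ℝ) : Prop where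
  cont : ContinuousOn f S
  slope_int : ∀ P ∈ S, ∀ v ∈ localDirs S P, ∃ s : ℤ, HasSlope S f P v s

/-- The outgoing slope of `f` at `P` in the direction `v` (defaulting to `0`
when no integer slope exists). -/
noncomputable def slope (S : Set (ℝ × ℝ)) (f : ℝ × ℝ → ℝ) (P : ℝ × ℝ) (v : ℤ × ℤ) : ℤ :=
  open scoped Classical in
  if h : ∃ s : ℤ, HasSlope S f P v s then h.choose else 0

/-- The order `ord_P f`: the sum of the outgoing slopes of `f` over all segments
of `S` emanating from `P`.  Points with `ord_P f > 0` are the zeros of `f`,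
points with `ord_P f < 0` its poles. -/
noncomputable def ord (S : Set (ℝ × ℝ)) (f : ℝ × ℝ → ℝ) (P : ℝ × ℝ) : ℤ :=
  ∑ᶠ v ∈ localDirs S P, slope S f P v

/-- Divisors: formal `ℤ`-linear combinations of finitely many points of `ℝ²`. -/
abbrev Div := (ℝ × ℝ) →₀ ℤ

/-- The degree of a divisor: the sum of its coefficients. -/
def deg (D : Div) : ℤ := D.sum fun _ n => n

/-- A divisor is effective (`D > 0`) when all its coefficients are nonnegative. -/
def Eff (D : Div) : Prop := ∀ P, 0 ≤ D P

/-- `R(D)`: the set of rational functions `f` on `S` with `(f) + D` effective. -/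
def RSet (S : Set (ℝ × ℝ)) (D : Div) : Set ((ℝ × ℝ) → ℝ) :=
  {f | IsRationalFn S f ∧ ∀ P ∈ S, 0 ≤ ord S f P + D P}

/-- A divisor is principal when it is the divisor `(f) = Σ_P (ord_P f)·P` of a
rational function `f` on `S`. -/
def IsPrincipal (S : Set (ℝ × ℝ)) (D : Div) : Prop :=
  ∃ f : (ℝ × ℝ) → ℝ, IsRationalFn S f ∧ ∀ P, D P = ord S f P

/-- Two divisors are (linearly) equivalent, `D ∼ D′`, when `D′ = D + (f)` for
some rational function `f` on `S`. -/
def LinEquiv (S : Set (ℝ × ℝ)) (D D' : Div) : Prop :=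
  ∃ f : (ℝ × ℝ) → ℝ, IsRationalFn S f ∧ ∀ P, D' P = D P + ord S f P

end TropicalHyperelliptic

/-! ## The cycles `α_i` and the set `𝔇̃_g^+(Γ)` -/

namespace TropicalHyperelliptic

/-- The basis cycle `α_i` (`1 ≤ i ≤ g`) of the fundamental group `π₁(Γ)`:
the cycle of `Γ` through the vertices `V_{i−1}`, `V_i` and their conjugates
`V_{i−1}′`, `V_i′`, i.e. the part of `Γ` in the vertical strip
`x(V_i) ≤ X ≤ x(V_{i−1})`. -/
def alphaCycle (g : ℕ) (c : ℤ → ℝ) (i : ℕ) : Set (ℝ × ℝ) :=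
  {P ∈ Gam g c | (V g c i).1 ≤ P.1 ∧ P.1 ≤ (V g c (i - 1)).1}

/-- The overlap `α_{k,k+1} = (α_k ∩ α_{k+1}) ∖ {endpoints}` (`1 ≤ k ≤ g − 1`):
the open vertical edge of `Γ` joining `V_k` to `V_k′`.  (For non-adjacent
indices the overlaps `α_i ∩ α_j` are empty.) -/
def alphaOpen (g : ℕ) (c : ℤ → ℝ) (k : ℕ) : Set (ℝ × ℝ) :=
  {P ∈ Gam g c | P.1 = (V g c k).1 ∧ P ≠ V g c k ∧ P ≠ conj c (V g c k)}

/-- The subset `𝔇̃_g^+(Γ)` of `𝔇_g^+(Γ)`: effective divisors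
`P_1 + ⋯ + P_g` with `P_i ∈ α_i` for all `i`, such that each overlap `α_{ij}`
contains at most one of the points. -/
def Dtilde (g : ℕ) (c : ℤ → ℝ) : Set Div :=
  {D | ∃ Pt : Fin g → ℝ × ℝ,
    (∀ i : Fin g, Pt i ∈ alphaCycle g c (i + 1)) ∧
    (∀ k : ℕ, 1 ≤ k → k ≤ g - 1 →
      ∀ i j : Fin g, Pt i ∈ alphaOpen g c k → Pt j ∈ alphaOpen g c k → i = j) ∧
    D = ∑ i : Fin g, Finsupp.single (Pt i) (1 : ℤ)}

/-- For even `g`, the base divisor `D* = (g/2)(V_0 + V_0′)`. -/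
noncomputable def DstarEven (g : ℕ) (c : ℤ → ℝ) : Div :=
  ((g / 2 : ℕ) : ℤ) •
    (Finsupp.single (V g c 0) (1 : ℤ) + Finsupp.single (conj c (V g c 0)) (1 : ℤ))

/-- For odd `g`, the base divisor `D* = ((g−1)/2)(V_0 + V_0′) + V_0`. -/
noncomputable def DstarOdd (g : ℕ) (c : ℤ → ℝ) : Div :=
  (((g - 1) / 2 : ℕ) : ℤ) •
    (Finsupp.single (V g c 0) (1 : ℤ) + Finsupp.single (conj c (V g c 0)) (1 : ℤ))
  + Finsupp.single (V g c 0) (1 : ℤ)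

end TropicalHyperelliptic

namespace TropicalHyperelliptic

/-- For even `g`, the divisor `V_1 + V_3 + ⋯ + V_{g−1} + V_1′ + V_3′ + ⋯ + V_{g−1}′`. -/
noncomputable def OdivEven (g : ℕ) (c : ℤ → ℝ) : Div :=
  ∑ j : Fin (g / 2),
    (Finsupp.single (V g c (2 * (j : ℕ) + 1)) (1 : ℤ)
      + Finsupp.single (conj c (V g c (2 * (j : ℕ) + 1))) (1 : ℤ))

end TropicalHyperelliptic


namespace TropLadder

/-- right slope -/
def RS (h : ℝ → ℝ) (t : ℝ) (s : ℤ) : Prop :=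
  ∃ ε > (0 : ℝ), ∀ τ : ℝ, 0 ≤ τ → τ < ε → h (t + τ) = h t + (s : ℝ) * τ

/-- left slope -/
def LS (h : ℝ → ℝ) (t : ℝ) (s : ℤ) : Prop :=
  ∃ ε > (0 : ℝ), ∀ τ : ℝ, 0 ≤ τ → τ < ε → h (t - τ) = h t - (s : ℝ) * τ

/-- piecewise linear with integer slopes -/
structure PL (h : ℝ → ℝ) (a b : ℝ) (r l : ℝ → ℤ) : Prop where
  cont : ContinuousOn h (Set.Icc a b)
  rs : ∀ t, a ≤ t → t < b → RS h t (r t)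
  ls : ∀ t, a < t → t ≤ b → LS h t (l t)

variable {h h' : ℝ → ℝ} {a b : ℝ} {r l r' l' : ℝ → ℤ}

theorem PL.neg (H : PL h a b r l) :
    PL (fun t => - h t) a b (fun t => - r t) (fun t => - l t) := by
  refine ⟨H.cont.neg, fun t h1 h2 => ?_, fun t h1 h2 => ?_⟩
  · obtain ⟨ε, he, hh⟩ := H.rs t h1 h2
    refine ⟨ε, he, fun τ t1 t2 => ?_⟩
    simp only [hh τ t1 t2]; push_cast; ring
  · obtain ⟨ε, he, hh⟩ := H.ls t h1 h2
    refine ⟨ε, he, fun τ t1 t2 => ?_⟩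
    simp only [hh τ t1 t2]; push_cast; ring

theorem PL.sub (H : PL h a b r l) (H' : PL h' a b r' l') :
    PL (fun t => h t - h' t) a b (fun t => r t - r' t) (fun t => l t - l' t) := by
  refine ⟨H.cont.sub H'.cont, fun t h1 h2 => ?_, fun t h1 h2 => ?_⟩
  · obtain ⟨ε, he, hh⟩ := H.rs t h1 h2
    obtain ⟨ε', he', hh'⟩ := H'.rs t h1 h2
    refine ⟨min ε ε', lt_min he he', fun τ t1 t2 => ?_⟩
    simp only [hh τ t1 (t2.trans_le (min_le_left _ _)), hh' τ t1 (t2.trans_le (min_le_right _ _))]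
    push_cast; ring
  · obtain ⟨ε, he, hh⟩ := H.ls t h1 h2
    obtain ⟨ε', he', hh'⟩ := H'.ls t h1 h2
    refine ⟨min ε ε', lt_min he he', fun τ t1 t2 => ?_⟩
    simp only [hh τ t1 (t2.trans_le (min_le_left _ _)), hh' τ t1 (t2.trans_le (min_le_right _ _))]
    push_cast; ring

theorem PL.mono (H : PL h a b r l) {a' b' : ℝ} (ha : a ≤ a') (hb : b' ≤ b) :
    PL h a' b' r l :=
  ⟨H.cont.mono (Set.Icc_subset_Icc ha hb), fun t h1 h2 => H.rs t (ha.trans h1) (h2.trans_le hb),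
    fun t h1 h2 => H.ls t (ha.trans_lt h1) (h2.trans hb)⟩

theorem PL.chord (H : PL h a b r l) (hab : a < b)
    (hJ : ∀ t, a < t → t < b → l t ≤ r t) (m : ℝ) (hm : h b - h a = m * (b - a)) :
    ∀ t, a ≤ t → t ≤ b → h t ≤ h a + m * (t - a) := by
  by_contra hcon
  push Not at hcon
  obtain ⟨t1, ht1a, ht1b, ht1⟩ := hcon
  set k : ℝ → ℝ := fun t => h t - m * (t - a) with hk
  have kc : ContinuousOn k (Set.Icc a b) := H.cont.sub (by fun_prop)
  have hcomp : IsCompact (Set.Icc a b) := isCompact_Icc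
  obtain ⟨t2, ht2, hmax⟩ := hcomp.exists_isMaxOn ⟨a, le_refl a, hab.le⟩ kc
  have hclosed : IsClosed (Set.Icc a b ∩ k ⁻¹' {k t2}) :=
    kc.preimage_isClosed_of_isClosed isClosed_Icc isClosed_singleton
  have hcomp2 : IsCompact (Set.Icc a b ∩ k ⁻¹' {k t2}) :=
    hcomp.of_isClosed_subset hclosed Set.inter_subset_left
  obtain ⟨t0, ⟨ht0, ht0k⟩, hleast⟩ := hcomp2.exists_isLeast ⟨t2, ht2, rfl⟩
  have ht0k' : k t0 = k t2 := ht0k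
  have hM : ∀ t, a ≤ t → t ≤ b → k t ≤ k t0 := fun t h1 h2 => by
    rw [ht0k']; exact hmax ⟨h1, h2⟩
  have hpos : h a < k t0 := by
    have := hM t1 ht1a ht1b
    simp only [hk] at this ⊢
    linarith
  have hka : k a = h a := by simp [hk]
  have hkb : k b = h a := by simp only [hk]; linarith
  have hat : a < t0 := lt_of_le_of_ne ht0.1 (fun e => by rw [← e, hka] at hpos; exact lt_irrefl _ hpos)
  have htb : t0 < b := lt_of_le_of_ne ht0.2 (fun e => by rw [e, hkb] at hpos; exact lt_irrefl _ hpos)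
  obtain ⟨ε, he, hr⟩ := H.rs t0 hat.le htb
  obtain ⟨ε', he', hl⟩ := H.ls t0 hat htb.le
  have h1 : ((r t0 : ℤ) : ℝ) ≤ m := by
    set τ := min (ε / 2) (b - t0) with hτ
    have p : 0 < τ := lt_min (by linarith) (by linarith)
    have p1 : τ ≤ ε / 2 := min_le_left _ _
    have p2 : τ ≤ b - t0 := min_le_right _ _
    have q1 := hr τ p.le (by linarith)
    have q2 := hM (t0 + τ) (by linarith) (by linarith)
    simp only [hk] at q2
    rw [q1] at q2
    by_contra hc
    push Not at hc
    nlinarith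
  have h3 : ((l t0 : ℤ) : ℝ) ≤ r t0 := by exact_mod_cast hJ t0 hat htb
  set τ := min (ε' / 2) (t0 - a) with hτ
  have p : 0 < τ := lt_min (by linarith) (by linarith)
  have p1 : τ ≤ ε' / 2 := min_le_left _ _
  have p2 : τ ≤ t0 - a := min_le_right _ _
  have q1 := hl τ p.le (by linarith)
  have q2 := hM (t0 - τ) (by linarith) (by linarith)
  have q3 : k t0 ≤ k (t0 - τ) := by
    simp only [hk]
    rw [q1]
    nlinarith
  have := hleast (a := t0 - τ) ⟨⟨by linarith, by linarith⟩, by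
    show k (t0 - τ) = k t2
    rw [← ht0k']; exact le_antisymm q2 q3⟩
  linarith

theorem PL.convex (H : PL h a b r l) (hab : a < b)
    (hJ : ∀ t, a < t → t < b → l t ≤ r t) :
    (r a : ℝ) * (b - a) ≤ h b - h a ∧ h b - h a ≤ (l b : ℝ) * (b - a) := by
  have hba : 0 < b - a := by linarith
  set m := (h b - h a) / (b - a) with hm
  have hm' : h b - h a = m * (b - a) := by rw [hm]; field_simp
  have hc := H.chord hab hJ m hm'
  rw [hm']
  constructor
  · apply mul_le_mul_of_nonneg_right _ hba.le
    obtain ⟨ε, he, hr⟩ := H.rs a le_rfl hab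
    set τ := min (ε / 2) (b - a) with hτ
    have p : 0 < τ := lt_min (by linarith) (by linarith)
    have p1 : τ ≤ ε / 2 := min_le_left _ _
    have p2 : τ ≤ b - a := min_le_right _ _
    have q1 := hr τ p.le (by linarith)
    have q2 := hc (a + τ) (by linarith) (by linarith)
    by_contra hc
    push Not at hc
    nlinarith
  · apply mul_le_mul_of_nonneg_right _ hba.le
    obtain ⟨ε, he, hl⟩ := H.ls b hab le_rfl
    set τ := min (ε / 2) (b - a) with hτ
    have p : 0 < τ := lt_min (by linarith) (by linarith)
    have p1 : τ ≤ ε / 2 := min_le_left _ _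
    have p2 : τ ≤ b - a := min_le_right _ _
    have q1 := hl τ p.le (by linarith)
    have q2 := hc (b - τ) (by linarith) (by linarith)
    by_contra hc
    push Not at hc
    nlinarith

theorem PL.convex' (H : PL h a b r l) (hab : a < b)
    (hJ : ∀ t, a < t → t < b → l t ≤ r t) : r a ≤ l b := by
  obtain ⟨h1, h2⟩ := H.convex hab hJ
  have : (r a : ℝ) ≤ l b := le_of_mul_le_mul_right (h1.trans h2) (by linarith)
  exact_mod_cast this

theorem PL.cell (H : PL h a b r l) (hab : a < b) (q : ℝ) (w : ℤ) (hw : 0 ≤ w)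
    (hJ : ∀ t, a < t → t < b → t ≠ q → l t ≤ r t)
    (hq : a < q → q < b → l q ≤ r q + w) :
    r a - w ≤ l b ∧ ((r a - w : ℤ) : ℝ) * (b - a) ≤ h b - h a ∧
      h b - h a ≤ ((l b + w : ℤ) : ℝ) * (b - a) := by
  have hw' : (0 : ℝ) ≤ w := by exact_mod_cast hw
  by_cases hi : a < q ∧ q < b
  · obtain ⟨h1, h2⟩ := hi
    have A := (H.mono le_rfl h2.le)
    have B := (H.mono h1.le le_rfl)
    have hA : ∀ t, a < t → t < q → l t ≤ r t := fun t t1 t2 => hJ t t1 (t2.trans h2) t2.ne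
    have hB : ∀ t, q < t → t < b → l t ≤ r t := fun t t1 t2 => hJ t (h1.trans t1) t2 t1.ne'
    have A1 := A.convex h1 hA
    have A2 := A.convex' h1 hA
    have B1 := B.convex h2 hB
    have B2 := B.convex' h2 hB
    have C := hq h1 h2
    have e1 : ((r a : ℤ) : ℝ) - w ≤ r q := by exact_mod_cast (by omega : r a - w ≤ r q)
    have e2 : ((l q : ℤ) : ℝ) ≤ l b + w := by exact_mod_cast (by omega : l q ≤ l b + w)
    refine ⟨by omega, ?_, ?_⟩
    · push_cast; nlinarith
    · push_cast; nlinarith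
  · have hJ' : ∀ t, a < t → t < b → l t ≤ r t := fun t t1 t2 =>
      hJ t t1 t2 (fun e => hi ⟨e ▸ t1, e ▸ t2⟩)
    have A1 := H.convex hab hJ'
    have A2 := H.convex' hab hJ'
    refine ⟨by omega, ?_, ?_⟩
    · push_cast; nlinarith
    · push_cast; nlinarith

theorem PL.flat (H : PL h a b r l) (hab : a < b)
    (hJ : ∀ t, a < t → t < b → l t = r t) (h0 : h a = h b) : r a = 0 ∧ l b = 0 := by
  have A := H.convex hab (fun t t1 t2 => (hJ t t1 t2).le)
  have B := H.neg.convex hab (fun t t1 t2 => neg_le_neg (hJ t t1 t2).ge)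
  simp only [h0, sub_self, Int.cast_neg] at A B
  have hba : 0 < b - a := by linarith
  constructor
  · have : (r a : ℝ) = 0 := by nlinarith
    exact_mod_cast this
  · have : (l b : ℝ) = 0 := by nlinarith
    exact_mod_cast this

theorem PL.nojump_pos (H : PL h a b r l) {q : ℝ} (h1 : a < q) (h2 : q < b)
    (hJ : ∀ t, a < t → t < b → t ≠ q → l t = r t) (hq : r q - l q = 1) (h0 : h a = h b) :
    False := by
  have A := (H.mono le_rfl h2.le)
  have B := (H.mono h1.le le_rfl)
  have hA : ∀ t, a < t → t < q → l t = r t := fun t t1 t2 => hJ t t1 (t2.trans h2) t2.ne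
  have hB : ∀ t, q < t → t < b → l t = r t := fun t t1 t2 => hJ t (h1.trans t1) t2 t1.ne'
  have A1 := A.convex h1 (fun t t1 t2 => (hA t t1 t2).le)
  have B1 := B.convex h2 (fun t t1 t2 => (hB t t1 t2).le)
  have A2 := A.neg.convex h1 (fun t t1 t2 => neg_le_neg (hA t t1 t2).ge)
  have B2 := B.neg.convex h2 (fun t t1 t2 => neg_le_neg (hB t t1 t2).ge)
  simp only [Int.cast_neg] at A2 B2
  have e : (r q : ℝ) = l q + 1 := by exact_mod_cast (by omega : r q = l q + 1)
  have c1 : h q - h a = (l q : ℝ) * (q - a) := by linarith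
  have c2 : h b - h q = (r q : ℝ) * (b - q) := by linarith
  rcases le_or_gt 0 (l q) with hl | hl
  · have hl' : (0 : ℝ) ≤ l q := by exact_mod_cast hl
    nlinarith
  · have hl' : (l q : ℝ) ≤ -1 := by exact_mod_cast (by omega : l q ≤ -1)
    nlinarith

theorem PL.nojump (H : PL h a b r l) {q : ℝ} (h1 : a < q) (h2 : q < b)
    (hJ : ∀ t, a < t → t < b → t ≠ q → l t = r t) (hq : r q - l q = 1 ∨ r q - l q = -1)
    (h0 : h a = h b) : False := by
  rcases hq with hq | hq
  · exact H.nojump_pos h1 h2 hJ hq h0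
  · exact H.neg.nojump_pos h1 h2 (fun t t1 t2 t3 => by simp only [hJ t t1 t2 t3]) (by omega)
      (by simp only [h0])

theorem ladder {g : ℕ} (hg : 1 ≤ g) {X : ℕ → ℝ} (hX : ∀ n < g, X (n + 1) < X n)
    {q : ℕ → ℝ}
    (H : ∀ n < g, PL h (X (n + 1)) (X n) r l) (r0 : r (X 0) = 0) (lg : l (X g) = 0)
    (hJ : ∀ n < g, ∀ t, X (n + 1) < t → t < X n → t ≠ q n → l t ≤ r t)
    (hJq : ∀ n < g, X (n + 1) < q n → q n < X n → l (q n) ≤ r (q n) + 1)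
    (hV : ∀ n ≤ g, 0 < h (X n) → 2 - (if 1 ≤ n ∧ q (n - 1) = X n then (1 : ℤ) else 0)
      - (if n < g ∧ q n = X n then (1 : ℤ) else 0) ≤ r (X n) - l (X n)) :
    ∀ n ≤ g, h (X n) ≤ 0 := by
  have key : ∀ n < g, ∃ w : ℤ, 0 ≤ w ∧
      (if n < g ∧ q n = X n then (1 : ℤ) else 0) + w +
        (if 1 ≤ n + 1 ∧ q (n + 1 - 1) = X (n + 1) then (1 : ℤ) else 0) ≤ 1 ∧
      (r (X (n + 1)) - w ≤ l (X n) ∧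
      ((r (X (n + 1)) - w : ℤ) : ℝ) * (X n - X (n + 1)) ≤ h (X n) - h (X (n + 1)) ∧
      h (X n) - h (X (n + 1)) ≤ ((l (X n) + w : ℤ) : ℝ) * (X n - X (n + 1))) := by
    intro n hn
    have hXn := hX n hn
    simp only [hn, true_and, Nat.add_sub_cancel, Nat.le_add_left]
    by_cases hi : X (n + 1) < q n ∧ q n < X n
    · refine ⟨1, by norm_num, ?_, (H n hn).cell hXn (q n) 1 (by norm_num) (hJ n hn) (hJq n hn)⟩
      rw [if_neg hi.2.ne, if_neg hi.1.ne']; norm_num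
    · refine ⟨0, by norm_num, ?_, (H n hn).cell hXn (q n) 0 (by norm_num) (hJ n hn)
        (fun a b => absurd ⟨a, b⟩ hi)⟩
      by_cases e : q n = X n
      · rw [if_pos e, if_neg (by rw [e]; exact hXn.ne')]; norm_num
      · rw [if_neg e]; split_ifs <;> norm_num
  have C : ∀ n ≤ g, 0 < h (X n) →
      (if 1 ≤ n ∧ q (n - 1) = X n then (1 : ℤ) else 0) ≤ - r (X n) := by
    intro n
    induction n with
    | zero => intro _ _; simp [r0]
    | succ n ih =>
      intro hn hpos
      obtain ⟨w, hw, hw2, k1, k2, k3⟩ := key n (by omega)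
      have hXn : 0 < X n - X (n + 1) := sub_pos.mpr (hX n (by omega))
      by_cases hp : 0 < h (X n)
      · have := ih (by omega) hp
        have := hV n (by omega) hp
        omega
      · have : ((r (X (n + 1)) - w : ℤ) : ℝ) < 0 := by
          by_contra hc
          push Not at hc
          nlinarith
        have : (r (X (n + 1)) - w : ℤ) < 0 := by exact_mod_cast this
        have hnn : 0 ≤ (if n < g ∧ q n = X n then (1 : ℤ) else 0) := by split_ifs <;> norm_num
        omega
  have S : ∀ n < g, 0 < h (X n) → 0 < h (X (n + 1)) := by
    intro n hn hp
    obtain ⟨w, hw, hw2, k1, k2, k3⟩ := key n hn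
    have hXn : 0 < X n - X (n + 1) := sub_pos.mpr (hX n hn)
    have a1 := C n hn.le hp
    have a2 := hV n hn.le hp
    have hnn : 0 ≤ (if 1 ≤ n + 1 ∧ q (n + 1 - 1) = X (n + 1) then (1 : ℤ) else 0) := by
      split_ifs <;> norm_num
    have : l (X n) + w ≤ -1 := by omega
    have : ((l (X n) + w : ℤ) : ℝ) ≤ -1 := by exact_mod_cast this
    nlinarith
  have G : ¬ 0 < h (X g) := by
    intro hp
    have a1 := C g le_rfl hp
    have a2 := hV g le_rfl hp
    simp only [lt_irrefl, false_and, if_false] at a2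
    omega
  intro n hn
  by_contra hc
  push Not at hc
  apply G
  obtain ⟨d, rfl⟩ := Nat.exists_eq_add_of_le hn
  clear hn
  have : ∀ k ≤ d, 0 < h (X (n + k)) := by
    intro k
    induction k with
    | zero => intro _; simpa using hc
    | succ k ih => intro hk; exact S (n + k) (by omega) (ih (by omega))
  exact this d le_rfl

end TropLadder

namespace TropicalHyperelliptic

open TropLadder

variable {g : ℕ} {c : ℤ → ℝ}

/-- abscissa of a vertex -/
def Vert (g : ℕ) (c : ℤ → ℝ) (x : ℝ) : Prop := ∃ n ≤ g, x = (V g c n).1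

theorem X_zero (hc : Hyp g c) : (V g c 0).1 = 0 := by
  obtain ⟨h1, h2, -⟩ := hc
  simp [V, h1, h2]

theorem X_g : (V g c g).1 = c 0 - c 1 := by simp [V]

theorem X_lt (hc : Hyp g c) (n : ℕ) (hn : n < g) : (V g c (n + 1)).1 < (V g c n).1 := by
  obtain ⟨h1, h2, h3, h4, h5⟩ := hc
  simp only [V]
  rcases Nat.eq_zero_or_pos n with rfl | hp
  · simp [h1, h2, h5]
  · have := h4 (g - n - 1) (by omega)
    have e : ((g - n - 1 : ℕ) : ℤ) = (g : ℤ) - n - 1 := by omega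
    rw [e] at this
    have e1 : (g : ℤ) - n - 1 + 2 = g - n + 1 := by ring
    have e2 : (g : ℤ) - n - 1 + 1 = g - n := by ring
    have e3 : (g : ℤ) - (n + 1 : ℕ) = g - n - 1 := by push_cast; ring
    rw [e1, e2] at this
    rw [e3, e2]
    linarith

theorem X_anti (hc : Hyp g c) {m n : ℕ} (hmn : m ≤ n) (hn : n ≤ g) :
    (V g c n).1 ≤ (V g c m).1 := by
  induction n, hmn using Nat.le_induction with
  | base => exact le_rfl
  | succ n hmn ih => exact (X_lt hc n (by omega)).le.trans (ih (by omega))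

theorem X_anti_lt (hc : Hyp g c) {m n : ℕ} (hmn : m < n) (hn : n ≤ g) :
    (V g c n).1 < (V g c m).1 :=
  (X_anti hc (Nat.succ_le_of_lt hmn) hn).trans_lt (X_lt hc m (by omega))

theorem X_inj (hc : Hyp g c) {m n : ℕ} (hm : m ≤ g) (hn : n ≤ g)
    (h : (V g c m).1 = (V g c n).1) : m = n := by
  rcases lt_trichotomy m n with h1 | h1 | h1
  · exact absurd h (X_anti_lt hc h1 hn).ne'
  · exact h1
  · exact absurd h (X_anti_lt hc h1 hm).ne

theorem Pt_ge {i : ℕ} (hi : i ≤ g + 1) (x : ℝ) : c (i : ℤ) + (i : ℝ) * x ≤ Ptilde g c x := by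
  unfold Ptilde
  exact Finset.le_sup' (fun i : ℕ => c (i : ℤ) + (i : ℝ) * x) (Finset.mem_range.mpr (by omega))

theorem Pt_gt (hc : Hyp g c) (x : ℝ) : c (-1) < 2 * Ptilde g c x := by
  have := Pt_ge (g := g) (c := c) (i := 0) (by omega) x
  simp at this
  linarith [hc.2.2.1]

theorem Pt_cont : Continuous (Ptilde g c) := by
  unfold Ptilde
  apply Continuous.finset_sup'_apply
  intro i _
  fun_prop

theorem Pt_eq (hc : Hyp g c) {n : ℕ} (hn : n < g) {x : ℝ} (h1 : (V g c (n + 1)).1 ≤ x)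
    (h2 : x ≤ (V g c n).1) :
    Ptilde g c x = c ((g : ℤ) - n) + (((g : ℤ) - n : ℤ) : ℝ) * x := by
  obtain ⟨m, rfl⟩ : ∃ m, g = m + n := ⟨g - n, by omega⟩
  have e : (((m + n : ℕ) : ℤ) - n : ℤ) = (m : ℕ) := by push_cast; ring
  -- y k = c k - c (k+1) = X (g - k)
  have hy : ∀ k : ℕ, k ≤ m + n → (V (m + n) c (m + n - k)).1 = c k - c ((k : ℤ) + 1) := by
    intro k hk
    have e : ((m + n : ℕ) : ℤ) - ((m + n - k : ℕ) : ℤ) = k := by omega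
    simp only [V, e]
  have up : ∀ d : ℕ, m + d ≤ m + n + 1 →
      c ((m + d : ℕ) : ℤ) + ((m + d : ℕ) : ℝ) * x ≤ c (m : ℤ) + (m : ℝ) * x := by
    intro d
    induction d with
    | zero => intro _; simp
    | succ d ih =>
      intro hd
      have i1 := ih (by omega)
      have i2 := hy (m + d) (by omega)
      have i3 := X_anti hc (m := m + n - (m + d)) (n := n) (by omega) (by omega)
      have e1 : ((m + (d + 1) : ℕ) : ℤ) = ((m + d : ℕ) : ℤ) + 1 := by push_cast; ring
      rw [e1]
      push_cast at *
      nlinarith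
  have down : ∀ d i : ℕ, i + d = m → c (i : ℤ) + (i : ℝ) * x ≤ c (m : ℤ) + (m : ℝ) * x := by
    intro d
    induction d with
    | zero => intro i hi; simp at hi; simp [hi]
    | succ d ih =>
      intro i hi
      have i1 := ih (i + 1) (by omega)
      have i2 := hy i (by omega)
      have i3 := X_anti hc (m := n + 1) (n := m + n - i) (by omega) (by omega)
      push_cast at *
      nlinarith
  rw [e]
  apply le_antisymm
  · unfold Ptilde
    apply Finset.sup'_le
    intro i hi
    rw [Finset.mem_range] at hi
    rcases le_total i m with h | h
    · exact down (m - i) i (by omega)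
    · obtain ⟨d, rfl⟩ := Nat.exists_eq_add_of_le h
      exact up d (by omega)
  · exact Pt_ge (by omega) x

theorem V_snd (hc : Hyp g c) (hg : 1 ≤ g) {n : ℕ} (hn : n ≤ g) :
    (V g c n).2 = Ptilde g c (V g c n).1 := by
  rcases Nat.lt_or_ge n g with h | h
  · rw [Pt_eq hc h (X_lt hc n h).le le_rfl]
    simp only [V]; push_cast; ring
  · obtain rfl : n = g := by omega
    obtain ⟨m, rfl⟩ : ∃ m, n = m + 1 := ⟨n - 1, by omega⟩
    rw [Pt_eq (n := m) hc (by omega) le_rfl (X_lt hc m (by omega)).le]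
    simp [V]

theorem exists_cell_right (_hc : Hyp g c) {x : ℝ} (h1 : (V g c g).1 ≤ x) (h2 : x < (V g c 0).1) :
    ∃ n < g, (V g c (n + 1)).1 ≤ x ∧ x < (V g c n).1 := by
  classical
  have hex : ∃ n, (V g c n).1 ≤ x := ⟨g, h1⟩
  have hs := Nat.find_spec hex
  have hle : Nat.find hex ≤ g := Nat.find_min' hex h1
  have h0 : Nat.find hex ≠ 0 := by
    intro h; rw [h] at hs; linarith
  obtain ⟨k, hk⟩ := Nat.exists_eq_succ_of_ne_zero h0
  refine ⟨k, by omega, ?_, ?_⟩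
  · rw [hk] at hs; exact hs
  · have := Nat.find_min hex (m := k) (by omega)
    push Not at this; exact this

theorem exists_cell_left (_hc : Hyp g c) {x : ℝ} (h1 : (V g c g).1 < x) (h2 : x ≤ (V g c 0).1) :
    ∃ n < g, (V g c (n + 1)).1 < x ∧ x ≤ (V g c n).1 := by
  classical
  have hex : ∃ n, (V g c n).1 < x := ⟨g, h1⟩
  have hs := Nat.find_spec hex
  have hle : Nat.find hex ≤ g := Nat.find_min' hex h1
  have h0 : Nat.find hex ≠ 0 := by
    intro h; rw [h] at hs; linarith
  obtain ⟨k, hk⟩ := Nat.exists_eq_succ_of_ne_zero h0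
  refine ⟨k, by omega, ?_, ?_⟩
  · rw [hk] at hs; exact hs
  · have := Nat.find_min hex (m := k) (by omega)
    push Not at this; exact this

theorem not_vert (hc : Hyp g c) {n : ℕ} (hn : n < g) {x : ℝ} (h1 : (V g c (n + 1)).1 < x)
    (h2 : x < (V g c n).1) : ¬ Vert g c x := by
  rintro ⟨k, hk, rfl⟩
  rcases Nat.lt_or_ge n k with h | h
  · exact absurd (X_anti hc (Nat.succ_le_of_lt h) hk) (not_le.mpr h1)
  · exact absurd (X_anti hc h hn.le) (not_le.mpr h2)

theorem exists_cell (hc : Hyp g c) {x : ℝ} (h1 : (V g c g).1 ≤ x) (h2 : x ≤ (V g c 0).1)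
    (hv : ¬ Vert g c x) : ∃ n < g, (V g c (n + 1)).1 < x ∧ x < (V g c n).1 := by
  have h2' : x < (V g c 0).1 := lt_of_le_of_ne h2 (fun e => hv ⟨0, by omega, e⟩)
  obtain ⟨n, hn, a, b⟩ := exists_cell_right hc h1 h2'
  exact ⟨n, hn, lt_of_le_of_ne a (fun e => hv ⟨n + 1, by omega, e.symm⟩), b⟩

theorem touch {F : ℝ × ℝ → ℝ} {p : ℝ × ℝ} (hF : DifferentiableAt ℝ F p) {α β γ : ℝ}
    (hle : ∀ P : ℝ × ℝ, α + β * P.1 + γ * P.2 ≤ F P) (heq : α + β * p.1 + γ * p.2 = F p)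
    (v : ℝ × ℝ) : fderiv ℝ F p v = β * v.1 + γ * v.2 := by
  set A : ℝ × ℝ →L[ℝ] ℝ :=
    β • ContinuousLinearMap.fst ℝ ℝ ℝ + γ • ContinuousLinearMap.snd ℝ ℝ ℝ with hA
  have hmin : IsLocalMin (fun P => F P - A P) p := by
    apply Filter.Eventually.of_forall
    intro P
    have := hle P
    simp [hA]
    linarith
  have h0 := hmin.fderiv_eq_zero
  have h1 : HasFDerivAt (fun P => F P - A P) (fderiv ℝ F p - A) p :=
    hF.hasFDerivAt.sub A.hasFDerivAt
  rw [h1.fderiv] at h0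
  have h2 : fderiv ℝ F p = A := sub_eq_zero.mp h0
  rw [h2]; simp [hA]

theorem not_diff {F : ℝ × ℝ → ℝ} {p : ℝ × ℝ} {α β γ α' β' γ' : ℝ}
    (hle : ∀ P : ℝ × ℝ, α + β * P.1 + γ * P.2 ≤ F P) (heq : α + β * p.1 + γ * p.2 = F p)
    (hle' : ∀ P : ℝ × ℝ, α' + β' * P.1 + γ' * P.2 ≤ F P)
    (heq' : α' + β' * p.1 + γ' * p.2 = F p) (hne : β ≠ β' ∨ γ ≠ γ') :
    ¬ DifferentiableAt ℝ F p := by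
  intro hF
  have h1 := touch hF hle heq
  have h2 := touch hF hle' heq'
  rcases hne with h | h
  · apply h; have := (h1 (1, 0)).symm.trans (h2 (1, 0)); simpa using this
  · apply h; have := (h1 (0, 1)).symm.trans (h2 (0, 1)); simpa using this

theorem Pt_attain (hc : Hyp g c) (hg : 1 ≤ g) {x : ℝ} (h1 : (V g c g).1 ≤ x)
    (h2 : x ≤ (V g c 0).1) : ∃ m : ℕ, m ≤ g + 1 ∧ Ptilde g c x = c m + m * x := by
  obtain ⟨n, hn, a, b⟩ : ∃ n < g, (V g c (n + 1)).1 ≤ x ∧ x ≤ (V g c n).1 := by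
    rcases h2.lt_or_eq with h | h
    · obtain ⟨n, hn, a, b⟩ := exists_cell_right hc h1 h
      exact ⟨n, hn, a, b.le⟩
    · exact ⟨0, by omega, h ▸ (X_lt hc 0 (by omega)).le, h.le⟩
  refine ⟨g - n, by omega, ?_⟩
  rw [Pt_eq hc hn a b]
  have e : ((g - n : ℕ) : ℤ) = (g : ℤ) - n := by omega
  have e' : ((g - n : ℕ) : ℝ) = (((g : ℤ) - n : ℤ) : ℝ) := by rw [← e]; simp
  rw [e, e']

theorem F_ge1 (P : ℝ × ℝ) : 0 + 0 * P.1 + 2 * P.2 ≤ Ftilde g c P := by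
  unfold Ftilde; have := le_max_left (2 * P.2) (max (P.2 + Ptilde g c P.1) (c (-1))); linarith

theorem F_ge2 (P : ℝ × ℝ) : c (-1) + 0 * P.1 + 0 * P.2 ≤ Ftilde g c P := by
  unfold Ftilde
  have := le_max_of_le_right (b := 2 * P.2) (le_max_right (P.2 + Ptilde g c P.1) (c (-1)))
  linarith

theorem F_ge3 {i : ℕ} (hi : i ≤ g + 1) (P : ℝ × ℝ) :
    c i + (i : ℝ) * P.1 + 1 * P.2 ≤ Ftilde g c P := by
  unfold Ftilde
  have := le_max_of_le_right (b := 2 * P.2) (le_max_left (P.2 + Ptilde g c P.1) (c (-1)))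
  have := Pt_ge (c := c) hi P.1
  linarith

theorem mem_curve (hc : Hyp g c) (hg : 1 ≤ g) {P : ℝ × ℝ} (h1 : (V g c g).1 ≤ P.1)
    (h2 : P.1 ≤ (V g c 0).1) :
    P ∈ curveBar g c ↔ (P.2 = Ptilde g c P.1 ∨ P.2 = c (-1) - Ptilde g c P.1 ∨
      (Vert g c P.1 ∧ c (-1) - Ptilde g c P.1 < P.2 ∧ P.2 < Ptilde g c P.1)) := by
  have hgt := Pt_gt hc P.1
  have hPc : Continuous (fun Q : ℝ × ℝ => Ptilde g c Q.1) := Pt_cont.comp continuous_fst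
  constructor
  · intro hP
    by_contra hcon
    push Not at hcon
    obtain ⟨n1, n2, n3⟩ := hcon
    apply hP
    rcases lt_or_gt_of_ne n1 with k1 | k1
    · rcases lt_or_gt_of_ne n2 with k2 | k2
      · -- below: F = c (-1)
        have ev : Ftilde g c =ᶠ[nhds P] fun _ => c (-1) := by
          have o1 : ∀ᶠ Q in nhds P, Q.2 + Ptilde g c Q.1 < c (-1) :=
            (continuous_snd.add hPc).continuousAt.eventually_lt continuousAt_const
              (show P.2 + Ptilde g c P.1 < c (-1) by linarith)
          have o2 : ∀ᶠ Q : ℝ × ℝ in nhds P, 2 * Q.2 < c (-1) :=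
            (continuous_const.mul continuous_snd).continuousAt.eventually_lt continuousAt_const
              (show 2 * P.2 < c (-1) by linarith)
          filter_upwards [o1, o2] with Q q1 q2
          unfold Ftilde
          rw [max_eq_right q1.le, max_eq_right q2.le]
        exact (differentiableAt_const _).congr_of_eventuallyEq ev
      · have hv : ¬ Vert g c P.1 := fun hv => absurd (n3 hv k2) (not_le.mpr k1)
        obtain ⟨n, hn, a, b⟩ := exists_cell hc h1 h2 hv
        have ev : Ftilde g c =ᶠ[nhds P] fun Q => Q.2 + (c ((g : ℤ) - n) + (((g : ℤ) - n : ℤ) : ℝ) * Q.1) := by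
          have o1 : ∀ᶠ Q in nhds P, c (-1) < Q.2 + Ptilde g c Q.1 :=
            continuousAt_const.eventually_lt (continuous_snd.add hPc).continuousAt
              (show c (-1) < P.2 + Ptilde g c P.1 by linarith)
          have o2 : ∀ᶠ Q : ℝ × ℝ in nhds P, 2 * Q.2 < Q.2 + Ptilde g c Q.1 :=
            (continuous_const.mul continuous_snd).continuousAt.eventually_lt
              (continuous_snd.add hPc).continuousAt
              (show 2 * P.2 < P.2 + Ptilde g c P.1 by linarith)
          have o3 : ∀ᶠ Q : ℝ × ℝ in nhds P, (V g c (n + 1)).1 < Q.1 :=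
            continuousAt_const.eventually_lt continuous_fst.continuousAt a
          have o4 : ∀ᶠ Q : ℝ × ℝ in nhds P, Q.1 < (V g c n).1 :=
            continuous_fst.continuousAt.eventually_lt continuousAt_const b
          filter_upwards [o1, o2, o3, o4] with Q q1 q2 q3 q4
          unfold Ftilde
          rw [max_eq_left q1.le, max_eq_right q2.le, Pt_eq hc hn q3.le q4.le]
        refine DifferentiableAt.congr_of_eventuallyEq ?_ ev
        fun_prop
    · have ev : Ftilde g c =ᶠ[nhds P] fun Q => 2 * Q.2 := by
        have o1 : ∀ᶠ Q : ℝ × ℝ in nhds P, Q.2 + Ptilde g c Q.1 < 2 * Q.2 :=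
          (continuous_snd.add hPc).continuousAt.eventually_lt
            (continuous_const.mul continuous_snd).continuousAt
            (show P.2 + Ptilde g c P.1 < 2 * P.2 by linarith)
        have o2 : ∀ᶠ Q : ℝ × ℝ in nhds P, c (-1) < 2 * Q.2 :=
          continuousAt_const.eventually_lt (continuous_const.mul continuous_snd).continuousAt
            (show c (-1) < 2 * P.2 by linarith)
        filter_upwards [o1, o2] with Q q1 q2
        unfold Ftilde
        exact max_eq_left (max_le q1.le q2.le)
      refine DifferentiableAt.congr_of_eventuallyEq ?_ ev
      fun_prop
  · rintro (h | h | ⟨⟨n, hn, hv⟩, h3, h4⟩)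
    · obtain ⟨m, hm, e⟩ := Pt_attain hc hg h1 h2
      have hF : Ftilde g c P = 2 * P.2 := by
        unfold Ftilde
        exact max_eq_left (max_le (by linarith) (by linarith))
      exact not_diff F_ge1 (by rw [hF]; ring) (F_ge3 hm) (by rw [hF]; linarith)
        (Or.inr (by norm_num))
    · obtain ⟨m, hm, e⟩ := Pt_attain hc hg h1 h2
      have hF : Ftilde g c P = c (-1) := by
        unfold Ftilde
        rw [max_eq_right (show P.2 + Ptilde g c P.1 ≤ c (-1) by linarith), max_eq_right (by linarith)]
      exact not_diff F_ge2 (by rw [hF]; ring) (F_ge3 hm) (by rw [hF]; linarith)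
        (Or.inr (by norm_num))
    · have hF : Ftilde g c P = P.2 + Ptilde g c P.1 := by
        unfold Ftilde
        rw [max_eq_left (show c (-1) ≤ P.2 + Ptilde g c P.1 by linarith), max_eq_right (by linarith)]
      have e1 : ((g - n : ℕ) : ℤ) = (g : ℤ) - n := by omega
      have e2 : ((g - n + 1 : ℕ) : ℤ) = (g : ℤ) - n + 1 := by omega
      have e1' : ((g - n : ℕ) : ℝ) = (g : ℝ) - n := by exact_mod_cast congrArg (Int.cast (R := ℝ)) e1
      have hs := V_snd hc hg hn
      rw [← hv] at hs
      have hP : Ptilde g c P.1 = c ((g : ℤ) - n) + ((g : ℝ) - n) * P.1 := by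
        rw [← hs, hv]; simp only [V]; push_cast; ring
      have hx : P.1 = c ((g : ℤ) - n) - c ((g : ℤ) - n + 1) := hv
      refine not_diff (F_ge3 (i := g - n) (by omega)) ?_ (F_ge3 (i := g - n + 1) (by omega)) ?_
        (Or.inl (by push_cast; intro h; linarith))
      · rw [hF, e1, e1', hP]; ring
      · rw [hF, e2, hP]; push_cast; rw [e1', ]; linarith

theorem mem_Gam (hc : Hyp g c) (hg : 1 ≤ g) {P : ℝ × ℝ} :
    P ∈ Gam g c ↔ (V g c g).1 ≤ P.1 ∧ P.1 ≤ (V g c 0).1 ∧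
      (P.2 = Ptilde g c P.1 ∨ P.2 = c (-1) - Ptilde g c P.1 ∨
      (Vert g c P.1 ∧ c (-1) - Ptilde g c P.1 < P.2 ∧ P.2 < Ptilde g c P.1)) := by
  unfold Gam
  rw [← X_g (g := g), ← X_zero hc]
  constructor
  · rintro ⟨h1, h2, h3⟩; exact ⟨h2, h3, (mem_curve hc hg h2 h3).mp h1⟩
  · rintro ⟨h2, h3, h1⟩; exact ⟨(mem_curve hc hg h2 h3).mpr h1, h2, h3⟩

theorem Gam_closed (hc : Hyp g c) (hg : 1 ≤ g) : IsClosed (Gam g c) := by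
  have hPc : Continuous (fun Q : ℝ × ℝ => Ptilde g c Q.1) := Pt_cont.comp continuous_fst
  have : Gam g c = ({P | (V g c g).1 ≤ P.1} ∩ {P | P.1 ≤ (V g c 0).1}) ∩
      ({P | P.2 = Ptilde g c P.1} ∪ ({P | P.2 = c (-1) - Ptilde g c P.1} ∪
      ((⋃ n ∈ Finset.range (g + 1), {P | P.1 = (V g c n).1}) ∩
        ({P | c (-1) - Ptilde g c P.1 ≤ P.2} ∩ {P | P.2 ≤ Ptilde g c P.1})))) := by
    ext P
    rw [mem_Gam hc hg]
    simp only [Set.mem_inter_iff, Set.mem_union, Set.mem_ofPred_eq, Set.mem_iUnion, exists_prop,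
      Finset.mem_range, Vert, Nat.lt_succ_iff]
    constructor
    · rintro ⟨h1, h2, h3 | h3 | ⟨h3, h4, h5⟩⟩
      · exact ⟨⟨h1, h2⟩, Or.inl h3⟩
      · exact ⟨⟨h1, h2⟩, Or.inr (Or.inl h3)⟩
      · exact ⟨⟨h1, h2⟩, Or.inr (Or.inr ⟨h3, h4.le, h5.le⟩)⟩
    · rintro ⟨⟨h1, h2⟩, h3 | h3 | ⟨h3, h4, h5⟩⟩
      · exact ⟨h1, h2, Or.inl h3⟩
      · exact ⟨h1, h2, Or.inr (Or.inl h3)⟩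
      · refine ⟨h1, h2, ?_⟩
        rcases h4.eq_or_lt with h4 | h4
        · exact Or.inr (Or.inl h4.symm)
        · rcases h5.eq_or_lt with h5 | h5
          · exact Or.inl h5
          · exact Or.inr (Or.inr ⟨h3, h4, h5⟩)
  rw [this]
  refine ((isClosed_le continuous_const continuous_fst).inter
    (isClosed_le continuous_fst continuous_const)).inter
    ((isClosed_eq continuous_snd hPc).union ((isClosed_eq continuous_snd
      (continuous_const.sub hPc)).union (IsClosed.inter ?_
      ((isClosed_le (continuous_const.sub hPc) continuous_snd).inter
        (isClosed_le continuous_snd hPc)))))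
  apply isClosed_biUnion_finset
  intro n _
  exact isClosed_eq continuous_fst continuous_const

end TropicalHyperelliptic

namespace TropicalHyperelliptic

open TropLadder Filter Topology

variable {g : ℕ} {c : ℤ → ℝ}

/-- upper point -/
noncomputable def U (g : ℕ) (c : ℤ → ℝ) (x : ℝ) : ℝ × ℝ := (x, Ptilde g c x)

theorem ev_gt_iff {p : ℝ → Prop} :
    (∀ᶠ t in 𝓝[>] (0 : ℝ), p t) ↔ ∃ ε > (0 : ℝ), ∀ t, 0 < t → t < ε → p t := by
  rw [Filter.Eventually, mem_nhdsGT_iff_exists_Ioo_subset]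
  constructor
  · rintro ⟨ε, he, hs⟩; exact ⟨ε, he, fun t h1 h2 => hs ⟨h1, h2⟩⟩
  · rintro ⟨ε, he, hs⟩; exact ⟨ε, he, fun t h => hs t h.1 h.2⟩

theorem mem_localDirs {S : Set (ℝ × ℝ)} {P : ℝ × ℝ} {v : ℤ × ℤ} :
    v ∈ localDirs S P ↔ IsCoprime v.1 v.2 ∧ ∀ᶠ t in 𝓝[>] (0 : ℝ), P + t • vr v ∈ S := by
  rw [ev_gt_iff]; rfl

theorem vr_add (P : ℝ × ℝ) (t : ℝ) (v : ℤ × ℤ) :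
    P + t • vr v = (P.1 + t * v.1, P.2 + t * v.2) := by
  ext <;> simp [vr]

/-- `M` is the slope of `Ptilde` on the side `e` of `x`, inside the strip. -/
def Side (g : ℕ) (c : ℤ → ℝ) (e : ℤ) (x : ℝ) (M : ℤ) : Prop :=
  ∀ᶠ t in 𝓝[>] (0 : ℝ), (V g c g).1 ≤ x + e * t ∧ x + e * t ≤ (V g c 0).1 ∧
    ¬ Vert g c (x + e * t) ∧ Ptilde g c (x + e * t) = Ptilde g c x + e * M * t

theorem side_right (hc : Hyp g c) {n : ℕ} (hn : n < g) {x : ℝ} (h1 : (V g c (n + 1)).1 ≤ x)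
    (h2 : x < (V g c n).1) : Side g c 1 x ((g : ℤ) - n) := by
  rw [Side, ev_gt_iff]
  refine ⟨(V g c n).1 - x, by linarith, fun t t1 t2 => ?_⟩
  have a1 := X_anti hc (m := n + 1) (n := g) (by omega) le_rfl
  have a2 := X_anti hc (m := 0) (n := n) (by omega) hn.le
  push_cast
  refine ⟨by linarith, by linarith, not_vert hc hn (by linarith) (by linarith), ?_⟩
  rw [Pt_eq hc hn h1 h2.le, Pt_eq hc hn (by linarith) (by linarith)]
  push_cast; ring

theorem side_left (hc : Hyp g c) {n : ℕ} (hn : n < g) {x : ℝ} (h1 : (V g c (n + 1)).1 < x)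
    (h2 : x ≤ (V g c n).1) : Side g c (-1) x ((g : ℤ) - n) := by
  rw [Side, ev_gt_iff]
  refine ⟨x - (V g c (n + 1)).1, by linarith, fun t t1 t2 => ?_⟩
  have a1 := X_anti hc (m := n + 1) (n := g) (by omega) le_rfl
  have a2 := X_anti hc (m := 0) (n := n) (by omega) hn.le
  push_cast
  refine ⟨by linarith, by linarith, not_vert hc hn (by linarith) (by linarith), ?_⟩
  rw [Pt_eq hc hn h1.le h2, Pt_eq hc hn (by linarith) (by linarith)]
  push_cast; ring

open Classical in
/-- chosen one-sided slope of `Ptilde` -/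
noncomputable def sl (g : ℕ) (c : ℤ → ℝ) (e : ℤ) (x : ℝ) : ℤ :=
  if h : ∃ M, Side g c e x M then h.choose else 0

theorem sl_right (hc : Hyp g c) {x : ℝ} (h1 : (V g c g).1 ≤ x) (h2 : x < (V g c 0).1) :
    Side g c 1 x (sl g c 1 x) := by
  obtain ⟨n, hn, a, b⟩ := exists_cell_right hc h1 h2
  have h : ∃ M, Side g c 1 x M := ⟨_, side_right hc hn a b⟩
  rw [sl, dif_pos h]; exact h.choose_spec

theorem sl_left (hc : Hyp g c) {x : ℝ} (h1 : (V g c g).1 < x) (h2 : x ≤ (V g c 0).1) :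
    Side g c (-1) x (sl g c (-1) x) := by
  obtain ⟨n, hn, a, b⟩ := exists_cell_left hc h1 h2
  have h : ∃ M, Side g c (-1) x M := ⟨_, side_left hc hn a b⟩
  rw [sl, dif_pos h]; exact h.choose_spec

theorem ev_lin {a b d : ℝ} (h : a < b) : ∀ᶠ t in 𝓝[>] (0 : ℝ), a < b + t * d := by
  have : ContinuousAt (fun t : ℝ => b + t * d) 0 := by fun_prop
  have := continuousAt_const.eventually_lt this (show a < b + 0 * d by simpa using h)
  exact this.filter_mono nhdsWithin_le_nhds

theorem ev_lin' {a b d : ℝ} (h : b < a) : ∀ᶠ t in 𝓝[>] (0 : ℝ), b + t * d < a := by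
  have := ev_lin (a := -a) (b := -b) (d := -d) (by linarith)
  filter_upwards [this] with t ht
  linarith

theorem Side.scale {e M k : ℤ} {x : ℝ} (h : Side g c e x M) (hk : 0 < k) :
    ∀ᶠ t in 𝓝[>] (0 : ℝ), (V g c g).1 ≤ x + t * (e * k : ℤ) ∧ x + t * (e * k : ℤ) ≤ (V g c 0).1 ∧
    ¬ Vert g c (x + t * (e * k : ℤ)) ∧
      Ptilde g c (x + t * (e * k : ℤ)) = Ptilde g c x + t * (e * k * M : ℤ) := by
  have hk' : (0 : ℝ) < k := by exact_mod_cast hk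
  have T : Tendsto (fun t : ℝ => t * k) (𝓝[>] 0) (𝓝[>] 0) := by
    rw [tendsto_nhdsWithin_iff]
    constructor
    · have : ContinuousAt (fun t : ℝ => t * k) 0 := by fun_prop
      have := this.tendsto
      simp only [zero_mul] at this
      exact this.mono_left nhdsWithin_le_nhds
    · filter_upwards [self_mem_nhdsWithin] with t ht
      exact mul_pos ht hk'
  filter_upwards [T.eventually h] with t ht
  have e1 : x + t * (e * k : ℤ) = x + e * (t * k) := by push_cast; ring
  rw [e1]
  refine ⟨ht.1, ht.2.1, ht.2.2.1, ?_⟩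
  rw [ht.2.2.2]; push_cast; ring

theorem Side.dirs (hc : Hyp g c) (hg : 1 ≤ g) {e M : ℤ} {x : ℝ} (h : Side g c e x M)
    (he : e * e = 1) {v : ℤ × ℤ} (hv : 0 < e * v.1) :
    v ∈ localDirs (Gam g c) (U g c x) ↔ v = (e, e * M) := by
  have hv1 : v.1 = e * (e * v.1) := by rw [← mul_assoc, he, one_mul]
  rw [mem_localDirs]
  constructor
  · rintro ⟨hcop, hev⟩
    have hs := h.scale hv
    rw [← hv1] at hs
    have hgt := Pt_gt hc x
    have l1 := ev_lin (a := c (-1) / 2) (b := Ptilde g c x) (d := v.2) (by linarith)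
    obtain ⟨t, ⟨⟨⟨ht1, ht2⟩, ht3⟩, ht0⟩⟩ := (((hev.and hs).and l1).and self_mem_nhdsWithin).exists
    have ht0' : (0 : ℝ) < t := ht0
    rw [vr_add, mem_Gam hc hg] at ht1
    obtain ⟨-, -, h3⟩ := ht1
    simp only [U] at h3
    have hgt2 := Pt_gt hc (x + t * v.1)
    have key : Ptilde g c x + t * v.2 = Ptilde g c (x + t * v.1) := by
      rcases h3 with h3 | h3 | ⟨h3, -⟩
      · exact h3
      · linarith
      · exact absurd h3 ht2.2.2.1
    rw [ht2.2.2.2] at key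
    have k2 : (v.2 : ℝ) = ((v.1 * M : ℤ) : ℝ) :=
      mul_left_cancel₀ ht0'.ne' (by linarith)
    have k3 : v.2 = v.1 * M := by exact_mod_cast k2
    rw [k3] at hcop
    have hu : IsUnit v.1 := hcop.isUnit_of_dvd' dvd_rfl (dvd_mul_right _ _)
    have hv1e : v.1 = e := by
      rcases Int.isUnit_iff.mp hu with q | q <;>
      rcases Int.isUnit_iff.mp (IsUnit.of_mul_eq_one e he) with q' | q' <;>
      rw [q, q'] at hv <;> omega
    ext
    · exact hv1e
    · rw [k3, hv1e]
  · rintro rfl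
    refine ⟨⟨e, 0, by simp [he]⟩, ?_⟩
    filter_upwards [h.scale (k := 1) one_pos] with t ht
    rw [vr_add, mem_Gam hc hg]
    simp only [U, mul_one] at ht ⊢
    exact ⟨ht.1, ht.2.1, Or.inl ht.2.2.2.symm⟩

theorem dirs_upper (hc : Hyp g c) (hg : 1 ≤ g) {x : ℝ} (h1 : (V g c g).1 ≤ x)
    (h2 : x ≤ (V g c 0).1) {v : ℤ × ℤ} :
    v ∈ localDirs (Gam g c) (U g c x) ↔ (x < (V g c 0).1 ∧ v = (1, sl g c 1 x)) ∨
      ((V g c g).1 < x ∧ v = (-1, - sl g c (-1) x)) ∨ (Vert g c x ∧ v = (0, -1)) := by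
  have hgt := Pt_gt hc x
  rcases lt_trichotomy v.1 0 with hv | hv | hv
  · have hvR : (v.1 : ℝ) < 0 := by exact_mod_cast hv
    rcases h1.lt_or_eq with h | h
    · have := (sl_left hc h h2).dirs hc hg (by norm_num) (v := v) (by linarith)
      rw [this]
      constructor
      · intro e; right; left; exact ⟨h, by rw [e]; simp⟩
      · rintro (⟨-, e⟩ | ⟨-, e⟩ | ⟨-, e⟩)
        · rw [e] at hv; simp at hv
        · rw [e]; simp
        · rw [e] at hv; simp at hv
    · constructor
      · intro hm
        rw [mem_localDirs] at hm
        obtain ⟨t, ht1, ht0⟩ := (hm.2.and self_mem_nhdsWithin).exists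
        have ht0' : (0 : ℝ) < t := ht0
        rw [vr_add, mem_Gam hc hg] at ht1
        have := ht1.1
        simp only [U] at this
        nlinarith
      · rintro (⟨-, e⟩ | ⟨h', -⟩ | ⟨-, e⟩)
        · rw [e] at hv; simp at hv
        · linarith
        · rw [e] at hv; simp at hv
  · rw [mem_localDirs]
    constructor
    · rintro ⟨hcop, hev⟩
      rw [hv, isCoprime_zero_left, Int.isUnit_iff] at hcop
      obtain ⟨t, ⟨⟨ht1, ht0⟩, ht2⟩⟩ := ((hev.and self_mem_nhdsWithin).and
        (ev_lin (a := c (-1) - Ptilde g c x) (b := Ptilde g c x) (d := v.2) (by linarith))).exists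
      have ht0' : (0 : ℝ) < t := ht0
      rw [vr_add, mem_Gam hc hg] at ht1
      obtain ⟨-, -, h3⟩ := ht1
      simp only [U, hv, Int.cast_zero, mul_zero, add_zero] at h3
      rcases hcop with q | q
      · exfalso
        rw [q] at h3 ht2; push_cast at h3 ht2
        rcases h3 with h3 | h3 | ⟨-, h3, h4⟩ <;> linarith
      · right; right
        have hve : v = (0, -1) := by ext <;> assumption
        rw [q] at h3 ht2; push_cast at h3 ht2
        rcases h3 with h3 | h3 | ⟨h3, -⟩
        · linarith
        · linarith
        · exact ⟨h3, hve⟩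
    · rintro (⟨-, e⟩ | ⟨-, e⟩ | ⟨h3, e⟩)
      · rw [e] at hv; simp at hv
      · rw [e] at hv; simp at hv
      · rw [e]
        refine ⟨⟨0, -1, by norm_num⟩, ?_⟩
        filter_upwards [ev_lin (a := c (-1) - Ptilde g c x) (b := Ptilde g c x) (d := -1)
          (by linarith), self_mem_nhdsWithin] with t ht ht0
        have ht0' : (0 : ℝ) < t := ht0
        rw [vr_add, mem_Gam hc hg]
        simp only [U, Int.cast_zero, mul_zero, add_zero]
        refine ⟨h1, h2, Or.inr (Or.inr ⟨h3, ?_, ?_⟩)⟩ <;> push_cast <;> linarith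
  · have hvR : (0 : ℝ) < v.1 := by exact_mod_cast hv
    rcases h2.lt_or_eq with h | h
    · have := (sl_right hc h1 h).dirs hc hg (by norm_num) (v := v) (by linarith)
      rw [this]
      constructor
      · intro e; left; exact ⟨h, by rw [e]; simp⟩
      · rintro (⟨-, e⟩ | ⟨-, e⟩ | ⟨-, e⟩)
        · rw [e]; simp
        · rw [e] at hv; simp at hv
        · rw [e] at hv; simp at hv
    · constructor
      · intro hm
        rw [mem_localDirs] at hm
        obtain ⟨t, ht1, ht0⟩ := (hm.2.and self_mem_nhdsWithin).exists
        have ht0' : (0 : ℝ) < t := ht0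
        rw [vr_add, mem_Gam hc hg] at ht1
        have := ht1.2.1
        simp only [U] at this
        nlinarith
      · rintro (⟨h', -⟩ | ⟨-, e⟩ | ⟨-, e⟩)
        · linarith
        · rw [e] at hv; simp at hv
        · rw [e] at hv; simp at hv

theorem dirs_vert (hc : Hyp g c) (hg : 1 ≤ g) {x y : ℝ} (h1 : (V g c g).1 ≤ x)
    (h2 : x ≤ (V g c 0).1) (hx : Vert g c x) (hy1 : c (-1) - Ptilde g c x < y)
    (hy2 : y < Ptilde g c x) {v : ℤ × ℤ} :
    v ∈ localDirs (Gam g c) (x, y) ↔ v = (0, 1) ∨ v = (0, -1) := by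
  have inside : ∀ d : ℤ, ∀ᶠ t in 𝓝[>] (0 : ℝ), ((x, y) : ℝ × ℝ) + t • vr (0, d) ∈ Gam g c := by
    intro d
    filter_upwards [ev_lin (d := d) hy1, ev_lin' (d := d) hy2] with t t1 t2
    rw [vr_add, mem_Gam hc hg]
    simp only [Int.cast_zero, mul_zero, add_zero]
    exact ⟨h1, h2, Or.inr (Or.inr ⟨hx, t1, t2⟩)⟩
  have aux : ∀ e M : ℤ, Side g c e x M → e * e = 1 → 0 < e * v.1 →
      ¬ v ∈ localDirs (Gam g c) (x, y) := by
    intro e M h he hv hm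
    have hv1 : v.1 = e * (e * v.1) := by rw [← mul_assoc, he, one_mul]
    have hs := h.scale hv
    rw [← hv1] at hs
    rw [mem_localDirs] at hm
    have l1 := ev_lin (a := 0) (b := Ptilde g c x - y) (d := (v.1 * M : ℤ) - v.2) (by linarith)
    have l2 := ev_lin (a := 0) (b := y - (c (-1) - Ptilde g c x)) (d := (v.1 * M : ℤ) + v.2)
      (by linarith)
    obtain ⟨t, ⟨⟨ht1, ht2⟩, ht3⟩, ht4⟩ := (((hm.2.and hs).and l1).and l2).exists
    rw [vr_add, mem_Gam hc hg] at ht1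
    obtain ⟨-, -, h3⟩ := ht1
    rcases h3 with h3 | h3 | ⟨h3, -⟩
    · simp only [ht2.2.2.2] at h3; nlinarith
    · simp only [ht2.2.2.2] at h3; nlinarith
    · exact ht2.2.2.1 h3
  constructor
  · intro hm
    rcases lt_trichotomy v.1 0 with hv | hv | hv
    · exfalso
      have hvR : (v.1 : ℝ) < 0 := by exact_mod_cast hv
      rcases h1.lt_or_eq with h | h
      · exact aux _ _ (sl_left hc h h2) (by norm_num) (by linarith) hm
      · rw [mem_localDirs] at hm
        obtain ⟨t, ht1, ht0⟩ := (hm.2.and self_mem_nhdsWithin).exists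
        have ht0' : (0 : ℝ) < t := ht0
        rw [vr_add, mem_Gam hc hg] at ht1
        have := ht1.1
        simp only at this
        nlinarith
    · rw [mem_localDirs, hv, isCoprime_zero_left, Int.isUnit_iff] at hm
      rcases hm.1 with q | q
      · left; ext <;> assumption
      · right; ext <;> assumption
    · exfalso
      have hvR : (0 : ℝ) < v.1 := by exact_mod_cast hv
      rcases h2.lt_or_eq with h | h
      · exact aux _ _ (sl_right hc h1 h) (by norm_num) (by linarith) hm
      · rw [mem_localDirs] at hm
        obtain ⟨t, ht1, ht0⟩ := (hm.2.and self_mem_nhdsWithin).exists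
        have ht0' : (0 : ℝ) < t := ht0
        rw [vr_add, mem_Gam hc hg] at ht1
        have := ht1.2.1
        simp only at this
        nlinarith
  · rintro (rfl | rfl) <;> rw [mem_localDirs]
    · exact ⟨⟨0, 1, by norm_num⟩, inside 1⟩
    · exact ⟨⟨0, -1, by norm_num⟩, inside (-1)⟩

theorem dirs_empty (hc : Hyp g c) (hg : 1 ≤ g) {P : ℝ × ℝ} (hP : P ∉ Gam g c) :
    localDirs (Gam g c) P = ∅ := by
  ext v
  simp only [Set.mem_empty_iff_false, iff_false]
  rw [mem_localDirs]
  rintro ⟨-, hev⟩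
  apply hP
  have T : Tendsto (fun t : ℝ => P + t • vr v) (𝓝[>] 0) (𝓝 P) := by
    have : ContinuousAt (fun t : ℝ => P + t • vr v) 0 := by fun_prop
    have := this.tendsto
    simp only [zero_smul, add_zero] at this
    exact this.mono_left nhdsWithin_le_nhds
  exact (Gam_closed hc hg).mem_of_tendsto T hev

open Classical in
theorem ord_upper (hc : Hyp g c) (hg : 1 ≤ g) (f : ℝ × ℝ → ℝ) {x : ℝ} (h1 : (V g c g).1 ≤ x)
    (h2 : x ≤ (V g c 0).1) :
    ord (Gam g c) f (U g c x) =
      (if x < (V g c 0).1 then slope (Gam g c) f (U g c x) (1, sl g c 1 x) else 0)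
      + (if (V g c g).1 < x then slope (Gam g c) f (U g c x) (-1, - sl g c (-1) x) else 0)
      + (if Vert g c x then slope (Gam g c) f (U g c x) (0, -1) else 0) := by
  have hs : localDirs (Gam g c) (U g c x) =
      (((if x < (V g c 0).1 then {(1, sl g c 1 x)} else ∅) ∪
        (if (V g c g).1 < x then {(-1, - sl g c (-1) x)} else ∅)) ∪
        (if Vert g c x then {(0, -1)} else ∅) : Finset (ℤ × ℤ)) := by
    ext v
    rw [dirs_upper hc hg h1 h2]
    split_ifs <;> simp [*]
  unfold ord
  rw [hs, finsum_mem_coe_finset, Finset.sum_union, Finset.sum_union]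
  · split_ifs <;> simp
  · split_ifs <;> simp
  · split_ifs <;> simp

theorem ord_vert (hc : Hyp g c) (hg : 1 ≤ g) (f : ℝ × ℝ → ℝ) {x y : ℝ} (h1 : (V g c g).1 ≤ x)
    (h2 : x ≤ (V g c 0).1) (hx : Vert g c x) (hy1 : c (-1) - Ptilde g c x < y)
    (hy2 : y < Ptilde g c x) :
    ord (Gam g c) f (x, y) =
      slope (Gam g c) f (x, y) (0, 1) + slope (Gam g c) f (x, y) (0, -1) := by
  have hs : localDirs (Gam g c) (x, y) = {(0, 1), (0, -1)} := by
    ext v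
    rw [dirs_vert hc hg h1 h2 hx hy1 hy2]
    simp
  unfold ord
  rw [hs, finsum_mem_pair (by simp)]

theorem ord_empty (hc : Hyp g c) (hg : 1 ≤ g) (f : ℝ × ℝ → ℝ) {P : ℝ × ℝ} (hP : P ∉ Gam g c) :
    ord (Gam g c) f P = 0 := by
  unfold ord
  rw [dirs_empty hc hg hP, finsum_mem_empty]

/-! conjugation -/

theorem conj_conj (P : ℝ × ℝ) : conj c (conj c P) = P := by
  ext <;> simp [conj]

theorem conj_cont : Continuous (conj c) := by
  unfold conj; fun_prop

theorem conj_mem (hc : Hyp g c) (hg : 1 ≤ g) {P : ℝ × ℝ} : conj c P ∈ Gam g c ↔ P ∈ Gam g c := by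
  have key : ∀ P : ℝ × ℝ, P ∈ Gam g c → conj c P ∈ Gam g c := by
    intro P hP
    rw [mem_Gam hc hg] at hP ⊢
    obtain ⟨h1, h2, h3⟩ := hP
    refine ⟨h1, h2, ?_⟩
    simp only [conj]
    rcases h3 with h3 | h3 | ⟨h3, h4, h5⟩
    · right; left; linarith
    · left; linarith
    · right; right; exact ⟨h3, by linarith, by linarith⟩
  exact ⟨fun h => by simpa [conj_conj] using key _ h, key P⟩

/-- reflection of directions -/
def rv (v : ℤ × ℤ) : ℤ × ℤ := (v.1, - v.2)

theorem conj_add (P : ℝ × ℝ) (t : ℝ) (v : ℤ × ℤ) :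
    conj c P + t • vr (rv v) = conj c (P + t • vr v) := by
  simp only [vr_add, conj, rv]; ext
  · simp
  · simp; ring

theorem rv_rv (v : ℤ × ℤ) : rv (rv v) = v := by simp [rv]

theorem dirs_conj (hc : Hyp g c) (hg : 1 ≤ g) {P : ℝ × ℝ} {v : ℤ × ℤ} :
    rv v ∈ localDirs (Gam g c) (conj c P) ↔ v ∈ localDirs (Gam g c) P := by
  rw [mem_localDirs, mem_localDirs]
  simp only [conj_add, conj_mem hc hg]
  simp only [rv, IsCoprime.neg_right_iff]

theorem hasSlope_conj (hc : Hyp g c) (hg : 1 ≤ g) (f : ℝ × ℝ → ℝ) (P : ℝ × ℝ) (v : ℤ × ℤ) (s : ℤ) :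
    HasSlope (Gam g c) f (conj c P) (rv v) s ↔
      HasSlope (Gam g c) (fun Q => f (conj c Q)) P v s := by
  unfold HasSlope
  simp only [conj_add, conj_mem hc hg]

theorem slope_conj (hc : Hyp g c) (hg : 1 ≤ g) (f : ℝ × ℝ → ℝ) (P : ℝ × ℝ) (v : ℤ × ℤ) :
    slope (Gam g c) f (conj c P) (rv v) = slope (Gam g c) (fun Q => f (conj c Q)) P v := by
  have : HasSlope (Gam g c) f (conj c P) (rv v) =
      HasSlope (Gam g c) (fun Q => f (conj c Q)) P v := by
    ext s; exact hasSlope_conj hc hg f P v s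
  unfold slope
  generalize HasSlope (Gam g c) f (conj c P) (rv v) = A at *
  subst this
  rfl

theorem ord_conj (hc : Hyp g c) (hg : 1 ≤ g) (f : ℝ × ℝ → ℝ) (P : ℝ × ℝ) :
    ord (Gam g c) f (conj c P) = ord (Gam g c) (fun Q => f (conj c Q)) P := by
  have hs : localDirs (Gam g c) (conj c P) = Set.image rv (localDirs (Gam g c) P) := by
    ext v
    constructor
    · intro h
      exact ⟨rv v, by rw [← dirs_conj hc hg, rv_rv]; exact h, rv_rv v⟩
    · rintro ⟨w, hw, rfl⟩
      exact (dirs_conj hc hg).mpr hw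
  unfold ord
  rw [hs, finsum_mem_image]
  · simp only [slope_conj hc hg]
  · intro a _ b _ h
    have := congrArg rv h
    rwa [rv_rv, rv_rv] at this

theorem rational_conj (hc : Hyp g c) (hg : 1 ≤ g) {f : ℝ × ℝ → ℝ} (hf : IsRationalFn (Gam g c) f) :
    IsRationalFn (Gam g c) (fun Q => f (conj c Q)) := by
  constructor
  · exact hf.cont.comp conj_cont.continuousOn (fun P hP => (conj_mem hc hg).mpr hP)
  · intro P hP v hv
    obtain ⟨s, hs⟩ := hf.slope_int (conj c P) ((conj_mem hc hg).mpr hP) (rv v)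
      ((dirs_conj hc hg).mpr hv)
    exact ⟨s, (hasSlope_conj hc hg f P v s).mp hs⟩

theorem slope_spec {S : Set (ℝ × ℝ)} {f : ℝ × ℝ → ℝ} (hf : IsRationalFn S f) {P : ℝ × ℝ}
    (hP : P ∈ S) {v : ℤ × ℤ} (hv : v ∈ localDirs S P) : HasSlope S f P v (slope S f P v) := by
  have h := hf.slope_int P hP v hv
  rw [slope, dif_pos h]
  exact h.choose_spec

theorem slope_eq {S : Set (ℝ × ℝ)} {f : ℝ × ℝ → ℝ} {P : ℝ × ℝ}
    {v : ℤ × ℤ} (hv : v ∈ localDirs S P) {s : ℤ} (hs : HasSlope S f P v s) :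
    slope S f P v = s := by
  have h : ∃ s : ℤ, HasSlope S f P v s := ⟨s, hs⟩
  rw [slope, dif_pos h]
  obtain ⟨ε, he, h1⟩ := h.choose_spec
  obtain ⟨ε', he', h2⟩ := hs
  obtain ⟨-, ε'', he'', h3⟩ := hv
  set t := min ε (min ε' ε'') / 2 with ht
  have p : 0 < min ε (min ε' ε'') := lt_min he (lt_min he' he'')
  have p1 := min_le_left ε (min ε' ε'')
  have p2 := (min_le_right ε (min ε' ε'')).trans (min_le_left _ _)
  have p3 := (min_le_right ε (min ε' ε'')).trans (min_le_right _ _)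
  have tp : 0 < t := by linarith
  have m := h3 t tp (by linarith)
  have a := h1 t tp.le (by linarith) m
  have b := h2 t tp.le (by linarith) m
  have e : (h.choose : ℝ) = s := mul_right_cancel₀ tp.ne' (by linarith)
  exact_mod_cast e

end TropicalHyperelliptic

namespace TropicalHyperelliptic

open TropLadder Filter Topology

variable {g : ℕ} {c : ℤ → ℝ}

theorem V_eq_U (hc : Hyp g c) (hg : 1 ≤ g) {n : ℕ} (hn : n ≤ g) : V g c n = U g c (V g c n).1 := by
  ext
  · rfl
  · exact V_snd hc hg hn

theorem conj_U_ne (hc : Hyp g c) (x y : ℝ) : conj c (U g c x) ≠ U g c y := by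
  intro h
  have h1 : x = y := congrArg Prod.fst h
  have h2 : c (-1) - Ptilde g c x = Ptilde g c y := congrArg Prod.snd h
  subst h1
  linarith [Pt_gt hc x]

theorem U_mem (hc : Hyp g c) (hg : 1 ≤ g) {x : ℝ} (h1 : (V g c g).1 ≤ x)
    (h2 : x ≤ (V g c 0).1) : U g c x ∈ Gam g c :=
  (mem_Gam hc hg).mpr ⟨h1, h2, Or.inl rfl⟩

theorem V_mem (hc : Hyp g c) (hg : 1 ≤ g) {n : ℕ} (hn : n ≤ g) : V g c n ∈ Gam g c := by
  rw [V_eq_U hc hg hn]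
  exact U_mem hc hg (X_anti hc hn le_rfl) (X_anti hc (Nat.zero_le _) hn)

/-- the divisor of the vertex n plus its conjugate -/
noncomputable def pr (g : ℕ) (c : ℤ → ℝ) (n : ℕ) : Div :=
  Finsupp.single (V g c n) (1 : ℤ) + Finsupp.single (conj c (V g c n)) (1 : ℤ)

theorem pr_upper (hc : Hyp g c) (hg : 1 ≤ g) {n : ℕ} (hn : n ≤ g) (x : ℝ) :
    pr g c n (U g c x) = if x = (V g c n).1 then 1 else 0 := by
  classical
  have e := V_eq_U hc hg hn
  have h1 : conj c (V g c n) ≠ U g c x := by rw [e]; exact conj_U_ne hc _ _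
  rw [pr, Finsupp.add_apply, Finsupp.single_apply, Finsupp.single_apply, if_neg h1, add_zero]
  congr 1
  apply propext
  constructor
  · intro h; rw [h]; rfl
  · intro h; rw [h]; exact e

theorem pr_conj (n : ℕ) (P : ℝ × ℝ) : pr g c n (conj c P) = pr g c n P := by
  classical
  have i1 : (V g c n = conj c P) ↔ (conj c (V g c n) = P) :=
    ⟨fun h => by rw [h, conj_conj], fun h => by rw [← h, conj_conj]⟩
  have i2 : (conj c (V g c n) = conj c P) ↔ (V g c n = P) :=
    ⟨fun h => by rw [← conj_conj (c := c) (V g c n), h, conj_conj], fun h => by rw [h]⟩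
  simp only [pr, Finsupp.add_apply, Finsupp.single_apply, i1, i2]
  ring

theorem pr_zero (hc : Hyp g c) (hg : 1 ≤ g) {n : ℕ} (hn : n ≤ g) {P : ℝ × ℝ}
    (h1 : P.2 ≠ Ptilde g c P.1) (h2 : P.2 ≠ c (-1) - Ptilde g c P.1) : pr g c n P = 0 := by
  classical
  have e := V_eq_U hc hg hn
  rw [pr, Finsupp.add_apply, Finsupp.single_apply, Finsupp.single_apply, if_neg, if_neg, add_zero]
  · intro h; apply h2; rw [← h, e]; simp [conj, U]
  · intro h; apply h1; rw [← h, e]; simp [U]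

theorem pr_not_mem (hc : Hyp g c) (hg : 1 ≤ g) {n : ℕ} (hn : n ≤ g) {P : ℝ × ℝ}
    (h : P ∉ Gam g c) : pr g c n P = 0 := by
  classical
  have e := V_mem hc hg hn
  rw [pr, Finsupp.add_apply, Finsupp.single_apply, Finsupp.single_apply, if_neg, if_neg, add_zero]
  · intro h'; apply h; rw [← h']; exact (conj_mem hc hg).mpr e
  · intro h'; apply h; rw [← h']; exact e

theorem Odiv_apply (P : ℝ × ℝ) :
    OdivEven g c P = ∑ j ∈ Finset.range (g / 2), pr g c (2 * j + 1) P := by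
  rw [OdivEven, Finsupp.finsetSum_apply, Finset.sum_range]
  rfl

theorem Dstar_apply (P : ℝ × ℝ) : DstarEven g c P = ((g / 2 : ℕ) : ℤ) * pr g c 0 P := by
  rw [DstarEven, Finsupp.smul_apply]; rfl

/-- slope of `max x ξ` in direction `a` -/
noncomputable def ms (a : ℤ) (x ξ : ℝ) : ℤ := if ξ < x then a else if x < ξ then 0 else max a 0

theorem ms_spec (a : ℤ) (x ξ : ℝ) :
    ∀ᶠ t in 𝓝[>] (0 : ℝ), max (x + t * a) ξ = max x ξ + ms a x ξ * t := by
  rcases lt_trichotomy x ξ with h | h | h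
  · filter_upwards [ev_lin' (d := (a : ℝ)) h] with t ht
    rw [ms, if_neg (not_lt.mpr h.le), if_pos h, max_eq_right ht.le, max_eq_right h.le]; simp
  · subst h
    filter_upwards [self_mem_nhdsWithin] with t ht
    have ht0' : (0 : ℝ) < t := ht
    simp only [ms, lt_irrefl, if_false, max_self, Int.cast_max, Int.cast_zero]
    rcases le_total a 0 with ha | ha
    · have : (a : ℝ) ≤ 0 := by exact_mod_cast ha
      rw [max_eq_right this, max_eq_right (by nlinarith)]; ring
    · have : (0 : ℝ) ≤ a := by exact_mod_cast ha
      rw [max_eq_left this, max_eq_left (by nlinarith)]; ring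
  · filter_upwards [ev_lin (d := (a : ℝ)) h] with t ht
    rw [ms, if_pos h, max_eq_left ht.le, max_eq_left h.le]; ring

/-- the rational function with divisor `O - D*` -/
noncomputable def hfun (g : ℕ) (c : ℤ → ℝ) (P : ℝ × ℝ) : ℝ :=
  ∑ j ∈ Finset.range (g / 2), max P.1 (V g c (2 * j + 1)).1

theorem hfun_slope (S : Set (ℝ × ℝ)) (P : ℝ × ℝ) (v : ℤ × ℤ) :
    HasSlope S (hfun g c) P v
      (∑ j ∈ Finset.range (g / 2), ms v.1 P.1 (V g c (2 * j + 1)).1) := by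
  have : ∀ᶠ t in 𝓝[>] (0 : ℝ), ∀ j ∈ Finset.range (g / 2),
      max (P.1 + t * v.1) (V g c (2 * j + 1)).1 =
        max P.1 (V g c (2 * j + 1)).1 + ms v.1 P.1 (V g c (2 * j + 1)).1 * t := by
    rw [Filter.eventually_all_finset]
    intro j _
    exact ms_spec _ _ _
  rw [ev_gt_iff] at this
  obtain ⟨ε, he, h⟩ := this
  refine ⟨ε, he, fun t t1 t2 _ => ?_⟩
  rcases t1.eq_or_lt with rfl | t1
  · simp
  · rw [vr_add]
    simp only [hfun]
    rw [Finset.sum_congr rfl (h t t1 t2), Finset.sum_add_distrib]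
    push_cast
    rw [Finset.sum_mul]

theorem hfun_rational (S : Set (ℝ × ℝ)) : IsRationalFn S (hfun g c) := by
  refine ⟨Continuous.continuousOn ?_, fun P _ v _ => ⟨_, hfun_slope S P v⟩⟩
  unfold hfun
  fun_prop

theorem hfun_ord_upper (hc : Hyp g c) (hg2 : 2 ≤ g) {x : ℝ}
    (h1 : (V g c g).1 ≤ x) (h2 : x ≤ (V g c 0).1) (hg : Even g) :
    (OdivEven g c - DstarEven g c) (U g c x) = ord (Gam g c) (hfun g c) (U g c x) := by
  classical
  have hg1 : 1 ≤ g := by omega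
  have hX : (V g c g).1 < (V g c 0).1 := X_anti_lt hc (by omega) le_rfl
  rw [ord_upper hc hg1 _ h1 h2, Finsupp.sub_apply, Odiv_apply, Dstar_apply,
    pr_upper hc hg1 (Nat.zero_le _)]
  have s1 : (if x < (V g c 0).1 then slope (Gam g c) (hfun g c) (U g c x) (1, sl g c 1 x) else 0)
      = ∑ j ∈ Finset.range (g / 2), if x < (V g c 0).1 then ms 1 x (V g c (2 * j + 1)).1 else 0 := by
    split_ifs with h
    · exact slope_eq ((dirs_upper hc hg1 h1 h2).mpr (Or.inl ⟨h, rfl⟩)) (hfun_slope _ _ _)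
    · simp
  have s2 : (if (V g c g).1 < x then slope (Gam g c) (hfun g c) (U g c x) (-1, - sl g c (-1) x) else 0)
      = ∑ j ∈ Finset.range (g / 2), if (V g c g).1 < x then ms (-1) x (V g c (2 * j + 1)).1 else 0 := by
    split_ifs with h
    · exact slope_eq ((dirs_upper hc hg1 h1 h2).mpr (Or.inr (Or.inl ⟨h, rfl⟩))) (hfun_slope _ _ _)
    · simp
  have s3 : (if Vert g c x then slope (Gam g c) (hfun g c) (U g c x) (0, -1) else 0) = 0 := by
    split_ifs with h
    · rw [slope_eq ((dirs_upper hc hg1 h1 h2).mpr (Or.inr (Or.inr ⟨h, rfl⟩))) (hfun_slope _ _ _)]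
      apply Finset.sum_eq_zero
      intro j _
      simp [ms]
    · rfl
  rw [s1, s2, s3, add_zero, ← Finset.sum_add_distrib]
  have s4 : ((g / 2 : ℕ) : ℤ) * (if x = (V g c 0).1 then 1 else 0) =
      ∑ j ∈ Finset.range (g / 2), (if x = (V g c 0).1 then (1 : ℤ) else 0) := by
    rw [Finset.sum_const, Finset.card_range, nsmul_eq_mul]
  rw [s4, ← Finset.sum_sub_distrib]
  apply Finset.sum_congr rfl
  intro j hj
  rw [Finset.mem_range] at hj
  obtain ⟨k, rfl⟩ := hg
  have a1 : (V (k + k) c (k + k)).1 < (V (k + k) c (2 * j + 1)).1 :=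
    X_anti_lt hc (by omega) le_rfl
  have a2 : (V (k + k) c (2 * j + 1)).1 < (V (k + k) c 0).1 := X_anti_lt hc (by omega) (by omega)
  rw [pr_upper hc hg1 (by omega)]
  generalize (V (k + k) c (2 * j + 1)).1 = ξ at *
  unfold ms
  rcases lt_trichotomy x ξ with h | h | h
  · have n1 : x < (V (k + k) c 0).1 := by linarith
    simp [h, n1, not_lt.mpr h.le, h.ne, n1.ne]
  · subst h
    simp [a1, a2, a2.ne]
  · have n1 : (V (k + k) c (k + k)).1 < x := by linarith
    rcases h2.lt_or_eq with n2 | n2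
    · simp [h, n1, n2, h.ne', n2.ne]
    · simp [h, h.ne', n2, hX, n2 ▸ h, (n2 ▸ h).ne']

theorem principal_part (hc : Hyp g c) (hg : Even g) (hg2 : 2 ≤ g) :
    IsPrincipal (Gam g c) (OdivEven g c - DstarEven g c) := by
  have hg1 : 1 ≤ g := by omega
  have hodd : ∀ j ∈ Finset.range (g / 2), 2 * j + 1 ≤ g := by
    intro j hj; rw [Finset.mem_range] at hj; omega
  refine ⟨hfun g c, hfun_rational _, fun P => ?_⟩
  by_cases hP : P ∈ Gam g c
  · have hP' := hP
    rw [mem_Gam hc hg1] at hP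
    obtain ⟨h1, h2, h3 | h3 | ⟨h3, h4, h5⟩⟩ := hP
    · have : P = U g c P.1 := by ext <;> simp [U, h3]
      rw [this]
      exact hfun_ord_upper hc hg2 h1 h2 hg
    · have : P = conj c (U g c P.1) := by ext <;> simp [U, conj, h3]
      have e : (OdivEven g c - DstarEven g c) (conj c (U g c P.1)) =
          (OdivEven g c - DstarEven g c) (U g c P.1) := by
        simp only [Finsupp.sub_apply, Odiv_apply, Dstar_apply, pr_conj]
      rw [this, ord_conj hc hg1, e]
      exact hfun_ord_upper hc hg2 h1 h2 hg
    · have e : (OdivEven g c - DstarEven g c) P = 0 := by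
        rw [Finsupp.sub_apply, Odiv_apply, Dstar_apply, pr_zero hc hg1 (Nat.zero_le _) h5.ne h4.ne',
          Finset.sum_eq_zero]
        · simp
        · intro j hj
          exact pr_zero hc hg1 (hodd j hj) h5.ne h4.ne'
      rw [e, show P = (P.1, P.2) from rfl, ord_vert hc hg1 _ h1 h2 h3 h4 h5,
        slope_eq ((dirs_vert hc hg1 h1 h2 h3 h4 h5).mpr (Or.inl rfl)) (hfun_slope _ _ _),
        slope_eq ((dirs_vert hc hg1 h1 h2 h3 h4 h5).mpr (Or.inr rfl)) (hfun_slope _ _ _)]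
      rw [Finset.sum_eq_zero]
      · simp
      · intro j _; simp [ms]
  · rw [ord_empty hc hg1 _ hP, Finsupp.sub_apply, Odiv_apply, Dstar_apply,
      pr_not_mem hc hg1 (Nat.zero_le _) hP, Finset.sum_eq_zero]
    · simp
    · intro j hj
      exact pr_not_mem hc hg1 (hodd j hj) hP

theorem sum_two {M : Type*} [AddCommMonoid M] (F : ℕ → M) (k : ℕ) :
    ∑ i ∈ Finset.range (2 * k), F i = ∑ j ∈ Finset.range k, (F (2 * j) + F (2 * j + 1)) := by
  induction k with
  | zero => simp
  | succ k ih =>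
    rw [Finset.sum_range_succ, ← ih, show 2 * (k + 1) = 2 * k + 1 + 1 by ring,
      Finset.sum_range_succ, Finset.sum_range_succ, add_assoc]

theorem mem_part (hc : Hyp g c) (hg : Even g) (hg2 : 2 ≤ g) : OdivEven g c ∈ Dtilde g c := by
  have hg1 : 1 ≤ g := by omega
  obtain ⟨k, hk⟩ := hg
  set F : ℕ → ℝ × ℝ := fun i => if i % 2 = 0 then V g c (i + 1) else conj c (V g c i) with hF
  have hF' : ∀ i < g, ∃ n, n ≤ g ∧ (n = i ∨ n = i + 1) ∧ (F i = V g c n ∨ F i = conj c (V g c n)) := by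
    intro i hi
    simp only [hF]
    split_ifs with h
    · exact ⟨i + 1, by omega, Or.inr rfl, Or.inl rfl⟩
    · exact ⟨i, by omega, Or.inl rfl, Or.inr rfl⟩
  refine ⟨fun i => F i, ?_, ?_, ?_⟩
  · intro i
    obtain ⟨n, hn, hn2, h⟩ := hF' i i.2
    have m : F i ∈ Gam g c := by
      rcases h with h | h <;> rw [h]
      · exact V_mem hc hg1 hn
      · exact (conj_mem hc hg1).mpr (V_mem hc hg1 hn)
    have e : (F i).1 = (V g c n).1 := by
      rcases h with h | h <;> rw [h]
      rfl
    refine ⟨m, ?_, ?_⟩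
    · rw [e]; exact X_anti hc (by omega) (by omega)
    · rw [e]; exact X_anti hc (by omega) hn
  · intro m hm1 hm2 i j hi _
    exfalso
    obtain ⟨n, hn, hn2, h⟩ := hF' i i.2
    obtain ⟨-, h1, h2, h3⟩ := hi
    have e : (F i).1 = (V g c n).1 := by
      rcases h with h | h <;> rw [h]
      rfl
    have : n = m := X_inj hc hn (by omega) (e.symm.trans h1)
    subst this
    rcases h with h | h
    · exact h2 h
    · exact h3 h
  · rw [← Finset.sum_range (fun i => Finsupp.single (F i) (1 : ℤ)), OdivEven,
      show g = 2 * (g / 2) by omega, sum_two, Finset.sum_range]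
    rw [← show g = 2 * (g / 2) by omega]
    apply Finset.sum_congr rfl
    intro j _
    have e1 : F (2 * (j : ℕ)) = V g c (2 * j + 1) := by simp [hF]
    have e2 : F (2 * (j : ℕ) + 1) = conj c (V g c (2 * j + 1)) := by
      simp only [hF]; rw [if_neg (by omega)]
    rw [e1, e2]

end TropicalHyperelliptic

namespace TropicalHyperelliptic

open TropLadder Filter Topology

variable {g : ℕ} {c : ℤ → ℝ}

open Classical in
/-- right slope of `f ∘ U` -/
noncomputable def rF (g : ℕ) (c : ℤ → ℝ) (f : ℝ × ℝ → ℝ) (x : ℝ) : ℤ :=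
  if x < (V g c 0).1 then slope (Gam g c) f (U g c x) (1, sl g c 1 x) else 0

open Classical in
/-- left slope of `f ∘ U` -/
noncomputable def lF (g : ℕ) (c : ℤ → ℝ) (f : ℝ × ℝ → ℝ) (x : ℝ) : ℤ :=
  - (if (V g c g).1 < x then slope (Gam g c) f (U g c x) (-1, - sl g c (-1) x) else 0)

theorem PL_upper (hc : Hyp g c) (hg : 1 ≤ g) {f : ℝ × ℝ → ℝ} (hf : IsRationalFn (Gam g c) f) :
    PL (fun x => f (U g c x)) (V g c g).1 (V g c 0).1 (rF g c f) (lF g c f) := by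
  refine ⟨?_, fun x h1 h2 => ?_, fun x h1 h2 => ?_⟩
  · have : Continuous (U g c) := by
      unfold U; exact continuous_id.prodMk Pt_cont
    exact hf.cont.comp this.continuousOn (fun x hx => U_mem hc hg hx.1 hx.2)
  · obtain ⟨ε, he, hs⟩ := ev_gt_iff.mp (sl_right hc h1 h2)
    obtain ⟨δ, hd, hs'⟩ := slope_spec hf (U_mem hc hg h1 h2.le)
      ((dirs_upper hc hg h1 h2.le).mpr (Or.inl ⟨h2, rfl⟩))
    refine ⟨min ε δ, lt_min he hd, fun t t1 t2 => ?_⟩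
    rcases t1.eq_or_lt with rfl | t1
    · simp
    · obtain ⟨a1, a2, a3, a4⟩ := hs t t1 (t2.trans_le (min_le_left _ _))
      have e : U g c x + t • vr (1, sl g c 1 x) = U g c (x + t) := by
        rw [vr_add]
        simp only [Int.cast_one, one_mul] at a4
        ext
        · simp [U]
        · simp only [U, a4]; ring
      have m : U g c x + t • vr (1, sl g c 1 x) ∈ Gam g c := by
        rw [e]; simp only [Int.cast_one, one_mul] at a1 a2; exact U_mem hc hg a1 a2
      have := hs' t t1.le (t2.trans_le (min_le_right _ _)) m
      rw [e] at this
      simp only [rF, if_pos h2, this]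
  · obtain ⟨ε, he, hs⟩ := ev_gt_iff.mp (sl_left hc h1 h2)
    obtain ⟨δ, hd, hs'⟩ := slope_spec hf (U_mem hc hg h1.le h2)
      ((dirs_upper hc hg h1.le h2).mpr (Or.inr (Or.inl ⟨h1, rfl⟩)))
    refine ⟨min ε δ, lt_min he hd, fun t t1 t2 => ?_⟩
    rcases t1.eq_or_lt with rfl | t1
    · simp
    · obtain ⟨a1, a2, a3, a4⟩ := hs t t1 (t2.trans_le (min_le_left _ _))
      have ee : x + ((-1 : ℤ) : ℝ) * t = x - t := by push_cast; ring
      rw [ee] at a1 a2 a4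
      have e : U g c x + t • vr (-1, - sl g c (-1) x) = U g c (x - t) := by
        rw [vr_add]
        ext
        · simp [U]; ring
        · simp only [U, a4]; push_cast; ring
      have m : U g c x + t • vr (-1, - sl g c (-1) x) ∈ Gam g c := by
        rw [e]; exact U_mem hc hg a1 a2
      have := hs' t t1.le (t2.trans_le (min_le_right _ _)) m
      rw [e] at this
      simp only [lF, if_pos h1, this]
      push_cast; ring

theorem X_bounds (hc : Hyp g c) {k : ℕ} (hk : k ≤ g) :
    (V g c g).1 ≤ (V g c k).1 ∧ (V g c k).1 ≤ (V g c 0).1 :=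
  ⟨X_anti hc hk le_rfl, X_anti hc (Nat.zero_le _) hk⟩

theorem edge_mem (hc : Hyp g c) (hg : 1 ≤ g) {k : ℕ} (hk : k ≤ g) {y : ℝ}
    (h1 : c (-1) - Ptilde g c (V g c k).1 ≤ y) (h2 : y ≤ Ptilde g c (V g c k).1) :
    ((V g c k).1, y) ∈ Gam g c := by
  rw [mem_Gam hc hg]
  refine ⟨(X_bounds hc hk).1, (X_bounds hc hk).2, ?_⟩
  rcases h1.eq_or_lt with h | h
  · exact Or.inr (Or.inl h.symm)
  · rcases h2.eq_or_lt with h' | h'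
    · exact Or.inl h'
    · exact Or.inr (Or.inr ⟨⟨k, hk, rfl⟩, h, h'⟩)

theorem PL_edge (hc : Hyp g c) (hg : 1 ≤ g) {f : ℝ × ℝ → ℝ} (hf : IsRationalFn (Gam g c) f)
    {k : ℕ} (hk : k ≤ g) :
    PL (fun y => f ((V g c k).1, y)) (c (-1) - Ptilde g c (V g c k).1) (Ptilde g c (V g c k).1)
      (fun y => slope (Gam g c) f ((V g c k).1, y) (0, 1))
      (fun y => - slope (Gam g c) f ((V g c k).1, y) (0, -1)) := by
  obtain ⟨b1, b2⟩ := X_bounds hc hk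
  have hv : Vert g c (V g c k).1 := ⟨k, hk, rfl⟩
  have hgt := Pt_gt hc (V g c k).1
  have hconj : ((V g c k).1, c (-1) - Ptilde g c (V g c k).1) = conj c (U g c (V g c k).1) := rfl
  refine ⟨?_, fun y h1 h2 => ?_, fun y h1 h2 => ?_⟩
  · have : Continuous (fun y : ℝ => ((V g c k).1, y)) := by fun_prop
    exact hf.cont.comp this.continuousOn (fun x hx => edge_mem hc hg hk hx.1 hx.2)
  · have hd : ((0, 1) : ℤ × ℤ) ∈ localDirs (Gam g c) ((V g c k).1, y) := by
      rcases h1.eq_or_lt with h | h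
      · rw [← h, hconj, show ((0, 1) : ℤ × ℤ) = rv (0, -1) by simp [rv], dirs_conj hc hg,
          dirs_upper hc hg b1 b2]
        exact Or.inr (Or.inr ⟨hv, rfl⟩)
      · exact (dirs_vert hc hg b1 b2 hv h h2).mpr (Or.inl rfl)
    obtain ⟨δ, hd, hs'⟩ := slope_spec hf (edge_mem hc hg hk h1 h2.le) hd
    refine ⟨min δ (Ptilde g c (V g c k).1 - y), lt_min hd (by linarith), fun t t1 t2 => ?_⟩
    have a1 := t2.trans_le (min_le_left _ _)
    have a2 := t2.trans_le (min_le_right _ _)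
    have e : ((V g c k).1, y) + t • vr (0, 1) = ((V g c k).1, y + t) := by
      rw [vr_add]; simp
    have := hs' t t1 a1 (by rw [e]; exact edge_mem hc hg hk (by linarith) (by linarith))
    rw [e] at this
    exact this
  · have hd : ((0, -1) : ℤ × ℤ) ∈ localDirs (Gam g c) ((V g c k).1, y) := by
      rcases h2.eq_or_lt with h | h
      · rw [h]
        exact (dirs_upper hc hg b1 b2).mpr (Or.inr (Or.inr ⟨hv, rfl⟩))
      · exact (dirs_vert hc hg b1 b2 hv h1 h).mpr (Or.inr rfl)
    obtain ⟨δ, hd, hs'⟩ := slope_spec hf (edge_mem hc hg hk h1.le h2) hd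
    refine ⟨min δ (y - (c (-1) - Ptilde g c (V g c k).1)), lt_min hd (by linarith),
      fun t t1 t2 => ?_⟩
    have a1 := t2.trans_le (min_le_left _ _)
    have a2 := t2.trans_le (min_le_right _ _)
    have e : ((V g c k).1, y) + t • vr (0, -1) = ((V g c k).1, y - t) := by
      rw [vr_add]; ext <;> simp; ring
    have := hs' t t1 a1 (by rw [e]; exact edge_mem hc hg hk (by linarith) (by linarith))
    rw [e] at this
    simp only [this]; push_cast; ring

open Classical in
/-- the effective divisor of the points `pt i`, `i < g` -/
noncomputable def Ec (g : ℕ) (pt : ℕ → ℝ × ℝ) (P : ℝ × ℝ) : ℤ :=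
  ∑ i ∈ Finset.range g, if pt i = P then 1 else 0

/-- the open vertical edge over `x(V_k)` -/
def Op (g : ℕ) (c : ℤ → ℝ) (k : ℕ) (P : ℝ × ℝ) : Prop :=
  P.1 = (V g c k).1 ∧ c (-1) - Ptilde g c P.1 < P.2 ∧ P.2 < Ptilde g c P.1

/-- the situation in the uniqueness proof -/
structure Cfg (g : ℕ) (c : ℤ → ℝ) (pt : ℕ → ℝ × ℝ) (f : ℝ × ℝ → ℝ) (m : ℤ) : Prop where
  mem : ∀ i < g, pt i ∈ Gam g c
  lo : ∀ i < g, (V g c (i + 1)).1 ≤ (pt i).1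
  hi : ∀ i < g, (pt i).1 ≤ (V g c i).1
  one : ∀ k ≤ g, ∀ i < g, ∀ j < g, Op g c k (pt i) → Op g c k (pt j) → i = j
  rat : IsRationalFn (Gam g c) f
  ord : ∀ P, ord (Gam g c) f P = Ec g pt P - m * pr g c 0 P

variable {pt : ℕ → ℝ × ℝ} {f : ℝ × ℝ → ℝ} {m : ℤ}

theorem Ec_conj (P : ℝ × ℝ) : Ec g (fun i => conj c (pt i)) P = Ec g pt (conj c P) := by
  unfold Ec
  apply Finset.sum_congr rfl
  intro i _
  have : (conj c (pt i) = P) ↔ (pt i = conj c P) :=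
    ⟨fun h => by rw [← h, conj_conj], fun h => by rw [h, conj_conj]⟩
  simp only [this]

theorem Op_conj {k : ℕ} {P : ℝ × ℝ} (h : Op g c k (conj c P)) : Op g c k P := by
  obtain ⟨h1, h2, h3⟩ := h
  simp only [conj] at h1 h2 h3
  exact ⟨h1, by linarith, by linarith⟩

theorem Cfg.conj (hc : Hyp g c) (hg : 1 ≤ g) (C : Cfg g c pt f m) :
    Cfg g c (fun i => conj c (pt i)) (fun Q => f (conj c Q)) m where
  mem i hi := (conj_mem hc hg).mpr (C.mem i hi)
  lo i hi := C.lo i hi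
  hi i hi := C.hi i hi
  one k hk i hi j hj h1 h2 := C.one k hk i hi j hj (Op_conj h1) (Op_conj h2)
  rat := rational_conj hc hg C.rat
  ord P := by rw [← ord_conj hc hg, C.ord, Ec_conj, pr_conj]

theorem Ec_cell (hc : Hyp g c) (C : Cfg g c pt f m) {n : ℕ} (hn : n < g) {P : ℝ × ℝ}
    (h1 : (V g c (n + 1)).1 < P.1) (h2 : P.1 < (V g c n).1) [Decidable (pt n = P)] :
    Ec g pt P = if pt n = P then 1 else 0 := by
  unfold Ec
  rw [Finset.sum_eq_single n]
  · congr
  · intro i hi hne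
    rw [Finset.mem_range] at hi
    rw [if_neg]
    intro h
    subst h
    rcases Nat.lt_or_ge i n with h | h
    · exact absurd (X_anti hc (Nat.succ_le_of_lt h) hn.le) (not_le.mpr ((C.lo i hi).trans_lt h2))
    · exact absurd (X_anti hc (show n + 1 ≤ i by omega) hi.le)
        (not_le.mpr (h1.trans_le (C.hi i hi)))
  · intro h; exact absurd (Finset.mem_range.mpr hn) h

theorem only (hc : Hyp g c) (C : Cfg g c pt f m) {k i : ℕ} (hk : k ≤ g) (hi : i < g)
    (h : (pt i).1 = (V g c k).1) : i = k ∨ i + 1 = k := by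
  by_contra hcon
  push Not at hcon
  rcases Nat.lt_or_ge i k with h' | h'
  · exact absurd (X_anti_lt hc (show i + 1 < k by omega) hk) (not_lt.mpr (h ▸ C.lo i hi))
  · exact absurd (X_anti_lt hc (show k < i by omega) hi.le) (not_lt.mpr (h ▸ C.hi i hi))

/-- only two points can lie over `x(V_k)` -/
theorem sum_vertex (hc : Hyp g c) (C : Cfg g c pt f m) {k : ℕ} (hk : k ≤ g) (G : ℕ → ℤ)
    (hG : ∀ i < g, (pt i).1 ≠ (V g c k).1 → G i = 0) :
    ∑ i ∈ Finset.range g, G i = (if 1 ≤ k then G (k - 1) else 0) + (if k < g then G k else 0) := by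
  have hz : ∀ i < g, i ≠ k → i + 1 ≠ k → G i = 0 := by
    intro i hi h1 h2
    apply hG i hi
    intro h
    rcases only hc C hk hi h with h | h
    · exact h1 h
    · exact h2 h
  have e : ∀ i ∈ Finset.range g, G i = (if i = k then G i else 0) + (if i + 1 = k then G i else 0) := by
    intro i hi
    rw [Finset.mem_range] at hi
    by_cases h1 : i = k
    · rw [if_pos h1, if_neg (by omega), add_zero]
    · by_cases h2 : i + 1 = k
      · rw [if_neg h1, if_pos h2, zero_add]
      · rw [if_neg h1, if_neg h2, hz i hi h1 h2, add_zero]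
  rw [Finset.sum_congr rfl e, Finset.sum_add_distrib, add_comm]
  congr 1
  · split_ifs with h
    · rw [Finset.sum_eq_single (k - 1)]
      · rw [if_pos (by omega)]
      · intro i _ hi; rw [if_neg (by omega)]
      · intro h'; rw [Finset.mem_range] at h'; omega
    · apply Finset.sum_eq_zero
      intro i _; rw [if_neg (by omega)]
  · split_ifs with h
    · rw [Finset.sum_eq_single k]
      · rw [if_pos rfl]
      · intro i _ hi; rw [if_neg hi]
      · intro h'; rw [Finset.mem_range] at h'; omega
    · apply Finset.sum_eq_zero
      intro i hi; rw [Finset.mem_range] at hi; rw [if_neg (by omega)]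

open Classical in
/-- number of points on the open edge `k` -/
noncomputable def Nk (g : ℕ) (c : ℤ → ℝ) (pt : ℕ → ℝ × ℝ) (k : ℕ) : ℤ :=
  ∑ i ∈ Finset.range g, if Op g c k (pt i) then 1 else 0

theorem tri (hc : Hyp g c) (hg : 1 ≤ g) {k : ℕ} (hk : k ≤ g) {P : ℝ × ℝ} (hP : P ∈ Gam g c)
    (h : P.1 = (V g c k).1) : P = V g c k ∨ P = conj c (V g c k) ∨ Op g c k P := by
  obtain ⟨-, -, h3 | h3 | h3⟩ := (mem_Gam hc hg).mp hP
  · left; rw [V_eq_U hc hg hk, ← h, U, ← h3]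
  · right; left; rw [V_eq_U hc hg hk, ← h, U, TropicalHyperelliptic.conj]; simp only; rw [← h3]
  · exact Or.inr (Or.inr ⟨h, h3.2⟩)

theorem Op_not (hc : Hyp g c) (hg : 1 ≤ g) {k : ℕ} (hk : k ≤ g) :
    ¬ Op g c k (V g c k) ∧ ¬ Op g c k (conj c (V g c k)) := by
  have e := V_snd hc hg hk
  constructor
  · rintro ⟨-, -, h⟩; linarith
  · rintro ⟨-, h, -⟩; simp only [conj] at h; linarith

open Classical in
theorem count (hc : Hyp g c) (hg : 1 ≤ g) (C : Cfg g c pt f m) {k : ℕ} (hk : k ≤ g) :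
    (∑ i ∈ Finset.range g, if (pt i).1 = (V g c k).1 then (1 : ℤ) else 0) =
      Ec g pt (V g c k) + Ec g pt (conj c (V g c k)) + Nk g c pt k := by
  unfold Ec Nk
  rw [← Finset.sum_add_distrib, ← Finset.sum_add_distrib]
  apply Finset.sum_congr rfl
  intro i hi
  rw [Finset.mem_range] at hi
  have o := Op_not hc hg hk
  have ne : conj c (V g c k) ≠ V g c k := by
    rw [V_eq_U hc hg hk]; exact conj_U_ne hc _ _
  by_cases h : (pt i).1 = (V g c k).1
  · rw [if_pos h]
    rcases tri hc hg hk (C.mem i hi) h with e | e | e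
    · rw [e]; simp [o.1, ne.symm]
    · rw [e]; simp [o.2, ne]
    · have h1 : pt i ≠ V g c k := fun h => o.1 (h ▸ e)
      have h2 : pt i ≠ conj c (V g c k) := fun h => o.2 (h ▸ e)
      simp [e, h1, h2]
  · have h1 : pt i ≠ V g c k := fun h' => h (by rw [h'])
    have h2 : pt i ≠ conj c (V g c k) := fun h' => h (by rw [h']; rfl)
    have h3 : ¬ Op g c k (pt i) := fun h' => h h'.1
    simp [h, h1, h2, h3]

/-- either no point or exactly one point on the open edge -/
theorem edge_cases (C : Cfg g c pt f m) {k : ℕ} (hk : k ≤ g) :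
    (Nk g c pt k = 0 ∧ ∀ y, Op g c k ((V g c k).1, y) → Ec g pt ((V g c k).1, y) = 0) ∨
    (Nk g c pt k = 1 ∧ ∃ q, Op g c k ((V g c k).1, q) ∧ Ec g pt ((V g c k).1, q) = 1 ∧
      ∀ y, y ≠ q → Op g c k ((V g c k).1, y) → Ec g pt ((V g c k).1, y) = 0) := by
  classical
  by_cases h : ∃ i < g, Op g c k (pt i)
  · right
    obtain ⟨i, hi, ho⟩ := h
    have e : pt i = ((V g c k).1, (pt i).2) := by rw [← ho.1]
    refine ⟨?_, (pt i).2, e ▸ ho, ?_, ?_⟩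
    · unfold Nk
      rw [Finset.sum_eq_single i]
      · rw [if_pos ho]
      · intro j hj hne; rw [Finset.mem_range] at hj
        rw [if_neg]; intro h; exact hne (C.one k hk j hj i hi h ho)
      · intro h; exact absurd (Finset.mem_range.mpr hi) h
    · unfold Ec
      rw [Finset.sum_eq_single i]
      · rw [if_pos e]
      · intro j hj hne; rw [Finset.mem_range] at hj
        rw [if_neg]; intro h; rw [← e] at h
        exact hne (C.one k hk j hj i hi (h ▸ ho) ho)
      · intro h; exact absurd (Finset.mem_range.mpr hi) h
    · intro y hy hop
      unfold Ec
      apply Finset.sum_eq_zero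
      intro j hj; rw [Finset.mem_range] at hj
      rw [if_neg]
      intro h
      have : j = i := C.one k hk j hj i hi (h ▸ hop) ho
      subst this
      exact hy (by rw [h])
  · left
    push Not at h
    constructor
    · unfold Nk
      apply Finset.sum_eq_zero
      intro i hi
      rw [if_neg (h i (Finset.mem_range.mp hi))]
    · intro y hop
      unfold Ec
      apply Finset.sum_eq_zero
      intro j hj; rw [Finset.mem_range] at hj
      rw [if_neg]
      intro h'
      exact h j hj (h' ▸ hop)

/-- top slope of the edge `k` -/
noncomputable def st (g : ℕ) (c : ℤ → ℝ) (f : ℝ × ℝ → ℝ) (k : ℕ) : ℤ :=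
  - slope (Gam g c) f (U g c (V g c k).1) (0, -1)

/-- bottom slope of the edge `k` -/
noncomputable def sb (g : ℕ) (c : ℤ → ℝ) (f : ℝ × ℝ → ℝ) (k : ℕ) : ℤ :=
  slope (Gam g c) (fun Q => f (conj c Q)) (U g c (V g c k).1) (0, -1)

theorem sb_eq (hc : Hyp g c) (hg : 1 ≤ g) (k : ℕ) : sb g c f k =
    slope (Gam g c) f ((V g c k).1, c (-1) - Ptilde g c (V g c k).1) (0, 1) := by
  rw [sb, ← slope_conj hc hg]
  simp [rv, conj, U]

theorem edge_jump (hc : Hyp g c) (hg : 1 ≤ g) (C : Cfg g c pt f m) {k : ℕ} (hk : k ≤ g) {y : ℝ}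
    (h1 : c (-1) - Ptilde g c (V g c k).1 < y) (h2 : y < Ptilde g c (V g c k).1) :
    slope (Gam g c) f ((V g c k).1, y) (0, 1) - - slope (Gam g c) f ((V g c k).1, y) (0, -1)
      = Ec g pt ((V g c k).1, y) := by
  obtain ⟨b1, b2⟩ := X_bounds hc hk
  have := C.ord ((V g c k).1, y)
  rw [ord_vert hc hg f b1 b2 ⟨k, hk, rfl⟩ h1 h2,
    pr_zero hc hg (Nat.zero_le _) (P := ((V g c k).1, y)) h2.ne h1.ne'] at this
  linarith

/-- estimate for the vertical edge -/
theorem edge_pos (hc : Hyp g c) (hg : 1 ≤ g) (C : Cfg g c pt f m) {k : ℕ} (hk : k ≤ g)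
    (hpos : 0 < f (U g c (V g c k).1) - f (conj c (U g c (V g c k).1))) :
    2 - Nk g c pt k ≤ st g c f k + sb g c f k := by
  have H := PL_edge hc hg C.rat hk
  have hgt := Pt_gt hc (V g c k).1
  have hab : c (-1) - Ptilde g c (V g c k).1 < Ptilde g c (V g c k).1 := by linarith
  have hJ : ∀ t, c (-1) - Ptilde g c (V g c k).1 < t → t < Ptilde g c (V g c k).1 →
      - slope (Gam g c) f ((V g c k).1, t) (0, -1) ≤ slope (Gam g c) f ((V g c k).1, t) (0, 1) := by
    intro t t1 t2
    have e := edge_jump hc hg C hk t1 t2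
    have : 0 ≤ Ec g pt ((V g c k).1, t) := by
      unfold Ec; apply Finset.sum_nonneg; intro i _; split_ifs <;> norm_num
    linarith
  have c1 := (H.convex hab hJ).2
  have hs : 0 < st g c f k := by
    have h3 : (0 : ℝ) < (st g c f k : ℝ) * (Ptilde g c (V g c k).1 - (c (-1) - Ptilde g c (V g c k).1)) :=
      lt_of_lt_of_le hpos c1
    have := pos_of_mul_pos_left h3 (by linarith)
    exact_mod_cast this
  have hcell : st g c f k ≤ sb g c f k + Nk g c pt k := by
    rw [sb_eq hc hg]
    rcases edge_cases C hk with ⟨hN, hE⟩ | ⟨hN, q, hq, hq1, hE⟩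
    · have := H.neg.convex' hab (fun t t1 t2 => by
        have e := edge_jump hc hg C hk t1 t2
        rw [hE t ⟨rfl, t1, t2⟩] at e
        linarith)
      rw [hN]
      simp only [st, U]
      linarith
    · have := (H.neg.cell hab q 1 zero_le_one (fun t t1 t2 t3 => by
        have e := edge_jump hc hg C hk t1 t2
        rw [hE t t3 ⟨rfl, t1, t2⟩] at e
        linarith) (fun t1 t2 => by
        have e := edge_jump hc hg C hk t1 t2
        linarith)).1
      rw [hN]
      simp only [st, U]
      linarith
  linarith

theorem edge_zero (hc : Hyp g c) (hg : 1 ≤ g) (C : Cfg g c pt f m) {k : ℕ} (hk : k ≤ g)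
    (h0 : f (U g c (V g c k).1) - f (conj c (U g c (V g c k).1)) = 0) :
    Nk g c pt k = 0 ∧ st g c f k = 0 ∧ sb g c f k = 0 := by
  have H := PL_edge hc hg C.rat hk
  have hgt := Pt_gt hc (V g c k).1
  have hab : c (-1) - Ptilde g c (V g c k).1 < Ptilde g c (V g c k).1 := by linarith
  have h0' : f ((V g c k).1, c (-1) - Ptilde g c (V g c k).1) = f ((V g c k).1, Ptilde g c (V g c k).1) :=
    (sub_eq_zero.mp h0).symm
  rcases edge_cases C hk with ⟨hN, hE⟩ | ⟨hN, q, hq, hq1, hE⟩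
  · obtain ⟨a1, a2⟩ := H.flat hab (fun t t1 t2 => by
      have e := edge_jump hc hg C hk t1 t2
      rw [hE t ⟨rfl, t1, t2⟩] at e
      linarith) h0'
    exact ⟨hN, a2, (sb_eq hc hg k).trans a1⟩
  · exfalso
    refine H.nojump hq.2.1 hq.2.2 (fun t t1 t2 t3 => ?_) (Or.inl ?_) h0'
    · have e := edge_jump hc hg C hk t1 t2
      rw [hE t t3 ⟨rfl, t1, t2⟩] at e
      linarith
    · have e := edge_jump hc hg C hk hq.2.1 hq.2.2
      rw [hq1] at e
      exact e

/-- the slopes of `D = f ∘ U - f ∘ conj ∘ U` -/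
noncomputable def rD (g : ℕ) (c : ℤ → ℝ) (f : ℝ × ℝ → ℝ) (x : ℝ) : ℤ :=
  rF g c f x - rF g c (fun Q => f (conj c Q)) x

/-- the slopes of `D = f ∘ U - f ∘ conj ∘ U` -/
noncomputable def lD (g : ℕ) (c : ℤ → ℝ) (f : ℝ × ℝ → ℝ) (x : ℝ) : ℤ :=
  lF g c f x - lF g c (fun Q => f (conj c Q)) x

theorem PL_D (hc : Hyp g c) (hg : 1 ≤ g) (hf : IsRationalFn (Gam g c) f) :
    PL (fun x => f (U g c x) - f (conj c (U g c x))) (V g c g).1 (V g c 0).1 (rD g c f) (lD g c f) :=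
  (PL_upper hc hg hf).sub (PL_upper hc hg (rational_conj hc hg hf))

theorem D_jump (hc : Hyp g c) (hg : 1 ≤ g) (C : Cfg g c pt f m) {x : ℝ} (h1 : (V g c g).1 ≤ x)
    (h2 : x ≤ (V g c 0).1) (hv : ¬ Vert g c x) :
    rD g c f x - lD g c f x = Ec g pt (U g c x) - Ec g pt (conj c (U g c x)) := by
  have a := C.ord (U g c x)
  have b := (C.conj hc hg).ord (U g c x)
  rw [ord_upper hc hg _ h1 h2, if_neg hv] at a b
  rw [Ec_conj] at b
  unfold rD lD rF lF
  linarith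

theorem D_jump_vert (hc : Hyp g c) (hg : 1 ≤ g) (C : Cfg g c pt f m) {k : ℕ} (hk : k ≤ g) :
    rD g c f (V g c k).1 - lD g c f (V g c k).1 =
      Ec g pt (V g c k) - Ec g pt (conj c (V g c k)) + st g c f k + sb g c f k := by
  obtain ⟨h1, h2⟩ := X_bounds hc hk
  have hv : Vert g c (V g c k).1 := ⟨k, hk, rfl⟩
  have a := C.ord (U g c (V g c k).1)
  have b := (C.conj hc hg).ord (U g c (V g c k).1)
  rw [ord_upper hc hg _ h1 h2, if_pos hv] at a b
  rw [Ec_conj] at b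
  rw [← V_eq_U hc hg hk] at a b
  unfold rD lD rF lF st sb
  rw [← V_eq_U hc hg hk]
  linarith

/-- jumps in a cell -/
theorem cell_jump (hc : Hyp g c) (hg : 1 ≤ g) (C : Cfg g c pt f m) {n : ℕ} (hn : n < g) {x : ℝ}
    (h1 : (V g c (n + 1)).1 < x) (h2 : x < (V g c n).1) :
    (x ≠ (pt n).1 → rD g c f x - lD g c f x = 0) ∧
    (x = (pt n).1 → (rD g c f x - lD g c f x = 1 ∨ rD g c f x - lD g c f x = -1)) := by
  classical
  have b1 := (X_bounds hc hn).1
  have b2 := (X_bounds hc hn.le).2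
  have hv := not_vert hc hn h1 h2
  rw [D_jump hc hg C (b1.trans h1.le) (h2.le.trans b2) hv,
    Ec_cell hc C hn (P := U g c x) h1 h2, Ec_cell hc C hn (P := conj c (U g c x)) h1 h2]
  constructor
  · intro h
    rw [if_neg, if_neg]
    · rfl
    · intro h'; apply h; rw [h']; rfl
    · intro h'; apply h; rw [h']; rfl
  · intro h
    obtain ⟨-, -, h3 | h3 | h3⟩ := (mem_Gam hc hg).mp (C.mem n hn)
    · left
      have e : pt n = U g c x := by rw [h, U, ← h3]
      rw [e, if_pos rfl, if_neg (conj_U_ne hc x x).symm]; rfl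
    · right
      have e : pt n = conj c (U g c x) := by
        rw [h, U, TropicalHyperelliptic.conj]; simp only; rw [← h3]
      rw [e, if_pos rfl, if_neg (conj_U_ne hc x x)]; rfl
    · exact absurd (h ▸ h3.1) hv

theorem half (hc : Hyp g c) (hg : 1 ≤ g) (C : Cfg g c pt f m) : ∀ n ≤ g,
    f (U g c (V g c n).1) - f (conj c (U g c (V g c n).1)) ≤ 0 := by
  classical
  have H := PL_D hc hg C.rat
  refine ladder (X := fun n => (V g c n).1) (q := fun n => (pt n).1) hg (X_lt hc)
    (h := fun x => f (U g c x) - f (conj c (U g c x)))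
    (fun n hn => H.mono (X_bounds hc hn).1 (X_bounds hc hn.le).2) ?_ ?_ ?_ ?_ ?_
  · simp [rD, rF]
  · simp [lD, lF]
  · intro n hn t t1 t2 t3
    have := (cell_jump hc hg C hn t1 t2).1 t3
    linarith
  · intro n hn t1 t2
    have := (cell_jump hc hg C hn t1 t2).2 rfl
    omega
  · intro k hk hpos
    have a := edge_pos hc hg C hk hpos
    have b := D_jump_vert hc hg C hk
    have d := count hc hg C hk
    rw [sum_vertex hc C hk (fun i => if (pt i).1 = (V g c k).1 then (1 : ℤ) else 0)
      (fun i _ h => if_neg h)] at d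
    have n0 : 0 ≤ Ec g pt (V g c k) := by
      unfold Ec; apply Finset.sum_nonneg; intro i _; split_ifs <;> norm_num
    simp only [ite_and]
    linarith

theorem all_zero (hc : Hyp g c) (hg : 1 ≤ g) (C : Cfg g c pt f m) {n : ℕ} (hn : n ≤ g) :
    f (U g c (V g c n).1) - f (conj c (U g c (V g c n).1)) = 0 := by
  have a := half hc hg C n hn
  have b := half hc hg (C.conj hc hg) n hn
  simp only [conj_conj] at b
  linarith

theorem cell_no (hc : Hyp g c) (hg : 1 ≤ g) (C : Cfg g c pt f m) {n : ℕ} (hn : n < g) :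
    ((pt n).1 = (V g c n).1 ∨ (pt n).1 = (V g c (n + 1)).1) ∧
      rD g c f (V g c (n + 1)).1 = 0 ∧ lD g c f (V g c n).1 = 0 := by
  have H := (PL_D hc hg C.rat).mono (X_bounds hc hn).1 (X_bounds hc hn.le).2
  have h0 : f (U g c (V g c (n + 1)).1) - f (conj c (U g c (V g c (n + 1)).1)) =
      f (U g c (V g c n).1) - f (conj c (U g c (V g c n).1)) := by
    rw [all_zero hc hg C hn, all_zero hc hg C hn.le]
  have hX := X_lt hc n hn
  have key : (pt n).1 = (V g c n).1 ∨ (pt n).1 = (V g c (n + 1)).1 := by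
    by_contra hcon
    push Not at hcon
    have q1 := lt_of_le_of_ne (C.lo n hn) hcon.2.symm
    have q2 := lt_of_le_of_ne (C.hi n hn) hcon.1
    refine H.nojump q1 q2 (fun t t1 t2 t3 => ?_) ((cell_jump hc hg C hn q1 q2).2 rfl) h0
    have := (cell_jump hc hg C hn t1 t2).1 t3
    linarith
  refine ⟨key, H.flat hX (fun t t1 t2 => ?_) h0⟩
  have := (cell_jump hc hg C hn t1 t2).1 (by
    intro h
    rcases key with h' | h' <;> rw [← h, ] at h' <;> linarith)
  linarith

theorem balance (hc : Hyp g c) (hg : 1 ≤ g) (C : Cfg g c pt f m) {k : ℕ} (hk : k ≤ g) :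
    Nk g c pt k = 0 ∧ Ec g pt (V g c k) = Ec g pt (conj c (V g c k)) := by
  obtain ⟨a1, a2, a3⟩ := edge_zero hc hg C hk (all_zero hc hg C hk)
  refine ⟨a1, ?_⟩
  have b := D_jump_vert hc hg C hk
  have r0 : rD g c f (V g c k).1 = 0 := by
    rcases Nat.eq_zero_or_pos k with rfl | h
    · simp [rD, rF]
    · obtain ⟨j, rfl⟩ : ∃ j, k = j + 1 := ⟨k - 1, by omega⟩
      exact (cell_no hc hg C hk).2.1
  have l0 : lD g c f (V g c k).1 = 0 := by
    rcases hk.eq_or_lt with rfl | h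
    · simp [lD, lF]
    · exact (cell_no hc hg C h).2.2
  linarith

end TropicalHyperelliptic

namespace TropicalHyperelliptic

open TropLadder Filter Topology

variable {g : ℕ} {c : ℤ → ℝ} {pt : ℕ → ℝ × ℝ} {f : ℝ × ℝ → ℝ} {m : ℤ}

open Classical in
theorem parity (hc : Hyp g c) (hg : 1 ≤ g) (C : Cfg g c pt f m) {k : ℕ} (hk : k ≤ g) :
    (if 1 ≤ k then (if (pt (k - 1)).1 = (V g c k).1 then (1 : ℤ) else 0) else 0) +
      (if k < g then (if (pt k).1 = (V g c k).1 then (1 : ℤ) else 0) else 0) =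
      2 * Ec g pt (V g c k) := by
  have d := count hc hg C hk
  rw [sum_vertex hc C hk (fun i => if (pt i).1 = (V g c k).1 then (1 : ℤ) else 0)
      (fun i _ h => if_neg h)] at d
  obtain ⟨b1, b2⟩ := balance hc hg C hk
  rw [b1, ← b2] at d
  linarith

theorem step (hc : Hyp g c) (hg1 : 1 ≤ g) (C : Cfg g c pt f m) (j : ℕ) (hj : 2 * j + 1 < g)
    (hprev : 1 ≤ 2 * j → (pt (2 * j - 1)).1 ≠ (V g c (2 * j)).1) :
    (pt (2 * j)).1 = (V g c (2 * j + 1)).1 ∧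
      (pt (2 * j + 1)).1 = (V g c (2 * j + 1)).1 ∧ Ec g pt (V g c (2 * j + 1)) = 1 := by
  classical
  have p1 := parity hc hg1 C (k := 2 * j) (by omega)
  have p2 := parity hc hg1 C (k := 2 * j + 1) (by omega)
  have e1 : (if 1 ≤ 2 * j then (if (pt (2 * j - 1)).1 = (V g c (2 * j)).1 then (1 : ℤ) else 0)
      else 0) = 0 := by
    split_ifs with h1 h2
    · exact absurd h2 (hprev h1)
    · rfl
    · rfl
  rw [e1, if_pos (by omega)] at p1
  have n1 : (pt (2 * j)).1 ≠ (V g c (2 * j)).1 := by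
    intro h; rw [if_pos h] at p1; omega
  have h1 : (pt (2 * j)).1 = (V g c (2 * j + 1)).1 :=
    (cell_no hc hg1 C (n := 2 * j) (by omega)).1.resolve_left n1
  rw [if_pos (by omega), Nat.add_sub_cancel, if_pos h1, if_pos hj] at p2
  refine ⟨h1, ?_⟩
  by_cases h : (pt (2 * j + 1)).1 = (V g c (2 * j + 1)).1
  · rw [if_pos h] at p2; exact ⟨h, by omega⟩
  · rw [if_neg h] at p2; omega

theorem positions (hc : Hyp g c) (hg1 : 1 ≤ g) (C : Cfg g c pt f m) (j : ℕ)
    (hj : 2 * j + 1 < g) : (pt (2 * j)).1 = (V g c (2 * j + 1)).1 ∧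
      (pt (2 * j + 1)).1 = (V g c (2 * j + 1)).1 ∧ Ec g pt (V g c (2 * j + 1)) = 1 := by
  induction j with
  | zero => exact step hc hg1 C 0 hj (fun h => by omega)
  | succ j ih =>
    refine step hc hg1 C (j + 1) hj (fun _ h => ?_)
    rw [show 2 * (j + 1) - 1 = 2 * j + 1 by omega, (ih (by omega)).2.1] at h
    have := X_inj hc (by omega) (by omega) h
    omega

theorem pair_eq (hc : Hyp g c) (hg1 : 1 ≤ g) (C : Cfg g c pt f m) (j : ℕ)
    (hj : 2 * j + 1 < g) :
    Finsupp.single (pt (2 * j)) (1 : ℤ) + Finsupp.single (pt (2 * j + 1)) (1 : ℤ) =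
      pr g c (2 * j + 1) := by
  classical
  obtain ⟨h1, h2, h3⟩ := positions hc hg1 C j hj
  have hk : 2 * j + 1 ≤ g := hj.le
  have h4 : Ec g pt (conj c (V g c (2 * j + 1))) = 1 := by rw [← (balance hc hg1 C hk).2, h3]
  have h5 := (balance hc hg1 C hk).1
  unfold Ec at h3 h4
  unfold Nk at h5
  rw [sum_vertex hc C hk _ (fun i _ h => if_neg (fun h' => h (by rw [h']))),
    if_pos (by omega), if_pos hj, Nat.add_sub_cancel] at h3
  rw [sum_vertex hc C hk _ (fun i _ h => if_neg (fun h' => h (by rw [h']; rfl))),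
    if_pos (by omega), if_pos hj, Nat.add_sub_cancel] at h4
  rw [sum_vertex hc C hk _ (fun i _ h => if_neg (fun h' => h h'.1)),
    if_pos (by omega), if_pos hj, Nat.add_sub_cancel] at h5
  have o := Op_not hc hg1 hk
  have ne : conj c (V g c (2 * j + 1)) ≠ V g c (2 * j + 1) := by
    rw [V_eq_U hc hg1 hk]; exact conj_U_ne hc _ _
  unfold pr
  rcases tri hc hg1 hk (C.mem (2 * j) (by omega)) h1 with e | e | e <;>
  rcases tri hc hg1 hk (C.mem (2 * j + 1) hj) h2 with e' | e' | e'
  · rw [e, e'] at h3; simp at h3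
  · rw [e, e']
  · rw [if_pos e'] at h5; split_ifs at h5 <;> omega
  · rw [e, e', add_comm]
  · rw [e, e'] at h4; simp at h4
  · rw [if_pos e'] at h5; split_ifs at h5 <;> omega
  · rw [if_pos e] at h5; split_ifs at h5 <;> omega
  · rw [if_pos e] at h5; split_ifs at h5 <;> omega
  · rw [if_pos e] at h5; split_ifs at h5 <;> omega

theorem unique_part (hc : Hyp g c) (hg : Even g) (hg2 : 2 ≤ g) {E : Div} (hE : E ∈ Dtilde g c)
    (hp : IsPrincipal (Gam g c) (E - DstarEven g c)) : E = OdivEven g c := by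
  classical
  have hg1 : 1 ≤ g := by omega
  obtain ⟨Pt, hmem, hone, rfl⟩ := hE
  obtain ⟨f, hf, hord⟩ := hp
  set pt : ℕ → ℝ × ℝ := fun i => if h : i < g then Pt ⟨i, h⟩ else 0 with hpt
  have e : ∀ i (h : i < g), pt i = Pt ⟨i, h⟩ := fun i h => by simp only [hpt, dif_pos h]
  have e' : ∀ i : Fin g, Pt i = pt i := fun i => (e i i.2).symm
  have lo : ∀ i < g, (V g c (i + 1)).1 ≤ (pt i).1 := by
    intro i hi; rw [e i hi]; exact (hmem ⟨i, hi⟩).2.1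
  have hi' : ∀ i < g, (pt i).1 ≤ (V g c i).1 := by
    intro i hi; rw [e i hi]; exact (hmem ⟨i, hi⟩).2.2
  have mem : ∀ i < g, pt i ∈ Gam g c := by
    intro i hi; rw [e i hi]; exact (hmem ⟨i, hi⟩).1
  simp only [e'] at hord ⊢
  have C : Cfg g c pt f ((g / 2 : ℕ) : ℤ) := by
    refine ⟨mem, lo, hi', ?_, hf, ?_⟩
    · intro k hk i hi j hj h1 h2
      have o := Op_not hc hg1 hk
      rcases Nat.eq_zero_or_pos k with rfl | hk0
      · have z : ∀ i < g, Op g c 0 (pt i) → i = 0 := by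
          intro i hi h
          by_contra hne
          have := X_anti_lt hc (Nat.pos_of_ne_zero hne) hi.le
          have := hi' i hi
          have := h.1
          linarith
        rw [z i hi h1, z j hj h2]
      · rcases hk.eq_or_lt with rfl | hkg
        · have z : ∀ i < k, Op k c k (pt i) → i + 1 = k := by
            intro i hi h
            by_contra hne
            have := X_anti_lt hc (show i + 1 < k by omega) le_rfl
            have := lo i hi
            have := h.1
            linarith
          have := z i hi h1
          have := z j hj h2
          omega
        · have key : ∀ i (hi : i < g), Op g c k (pt i) → Pt ⟨i, hi⟩ ∈ alphaOpen g c k := by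
            intro i hi h
            rw [← e i hi]
            exact ⟨mem i hi, h.1, fun h' => o.1 (h' ▸ h), fun h' => o.2 (h' ▸ h)⟩
          have := hone k hk0 (by omega) ⟨i, hi⟩ ⟨j, hj⟩ (key i hi h1) (key j hj h2)
          exact congrArg Fin.val this
    · intro P
      rw [← hord P, Finsupp.sub_apply, Dstar_apply,
        ← Finset.sum_range (fun i => Finsupp.single (pt i) (1 : ℤ)), Finsupp.finsetSum_apply]
      unfold Ec
      simp only [Finsupp.single_apply]
  obtain ⟨k, hk⟩ := hg
  have hk2 : g = 2 * (g / 2) := by omega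
  rw [← Finset.sum_range (fun i => Finsupp.single (pt i) (1 : ℤ))]
  have s : ∑ i ∈ Finset.range g, Finsupp.single (pt i) (1 : ℤ) =
      ∑ j ∈ Finset.range (g / 2), pr g c (2 * j + 1) := by
    rw [show Finset.range g = Finset.range (2 * (g / 2)) by rw [← hk2], sum_two]
    apply Finset.sum_congr rfl
    intro j hj
    rw [Finset.mem_range] at hj
    exact pair_eq hc hg1 C j (by omega)
  rw [s]
  ext P
  rw [Odiv_apply, Finsupp.finsetSum_apply]

end TropicalHyperelliptic

open TropicalHyperelliptic

/-- Let `g` be even, `Γ̄` the tropical hyperelliptic curve of genus `g`, `Γ` its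
bounded part, and `D* = (g/2)(V_0 + V_0′)`.  The divisor
`V_1 + V_3 + ⋯ + V_{g−1} + V_1′ + V_3′ + ⋯ + V_{g−1}′` lies in `𝔇̃_g^+(Γ)` and is
the unique element of `𝔇̃_g^+(Γ)` whose image under `φ̄` is `0` in `J(Γ)`
(i.e. whose difference with `D*` is principal); hence the `g`-tuple
`(V_1, V_3, …, V_{g−1}, V_1′, V_3′, …, V_{g−1}′)` is the unit `𝒪` of the group
`(Γ_g^+, 𝒪)`. -/
theorem unit_of_addition_even (g : ℕ) (c : ℤ → ℝ) (hg : Even g) (hg2 : 2 ≤ g)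
    (hc : Hyp g c) :
    OdivEven g c ∈ Dtilde g c
    ∧ IsPrincipal (Gam g c) (OdivEven g c - DstarEven g c)
    ∧ ∀ E ∈ Dtilde g c, IsPrincipal (Gam g c) (E - DstarEven g c) → E = OdivEven g c := by
  exact ⟨mem_part hc hg hg2, principal_part hc hg hg2,
    fun E hE hp => unique_part hc hg hg2 hE hp⟩
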